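/- arXiv:2201.00535 — 7 statements merged into one kernel-verified Lean document; each statement's English description precedes it below -/
import Mathlib

section
/- For any four points A, B, C, D on the closed unit upper hemisphere S²_{≥0} = {(x,y,z) ∈ ℝ³ : x² + y² + z² = 1, z ≥ 0}, the sum of the six pairwise Euclidean distances satisfies |AB| + |AC| + |AD| + |BC| + |BD| + |CD| ≤ 4 + 4√2. -/
/-- Euclidean distance between two points of `ℝ × ℝ × ℝ`. -/
noncomputable def dist3 (P Q : ℝ × ℝ × ℝ) : ℝ :=
  Real.sqrt ((P.1 - Q.1) ^ 2 + (P.2.1 - Q.2.1) ^ 2 + (P.2.2 - Q.2.2) ^ 2)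

/-- The closed unit upper hemisphere `S²_{≥0}`. -/
def upperHemisphere : Set (ℝ × ℝ × ℝ) :=
  {p | p.1 ^ 2 + p.2.1 ^ 2 + p.2.2 ^ 2 = 1 ∧ 0 ≤ p.2.2}

/-- The tangent line to the square root at `c ^ 2`, with slope `m = 1 / (2 * c)`. -/
theorem sqrt_le_tangent {x : ℝ} (c m : ℝ) (hm : 0 ≤ m) (hcm : 2 * c * m = 1) (hx : 0 ≤ x) :
    √x ≤ m * x + c / 2 := by
  have h : m * x + c / 2 - √x = m * (√x - c) ^ 2 := by
    linear_combination (√x - c / 2) * hcm - m * Real.sq_sqrt hx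
  have : 0 ≤ m * (√x - c) ^ 2 := by positivity
  linarith

theorem sqrt_add_sqrt_le {x y z : ℝ} (hx : 0 ≤ x) (hy : 0 ≤ y) (h : 2 * (x + y) = z) :
    √x + √y ≤ √z := by
  apply Real.le_sqrt_of_sq_le
  nlinarith [sq_nonneg (√x - √y), Real.sq_sqrt hx, Real.sq_sqrt hy]

theorem mul_add_lt_sub_mul {p s k Y Z u v c d : ℝ} (hs : 0 ≤ s) (hp : 0 < p)
    (hps : k * s ≤ p) (hY : 0 < Y) (hZ : 0 < Z) (hu : u ≤ c * Y) (hv : v ≤ d * Z)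
    (hk : c + d < k - 1) : s * (u * Z + v * Y) < (p - s) * (Y * Z) := by
  have hm := mul_pos hY hZ
  rcases hs.eq_or_lt with rfl | hs
  · simpa using mul_pos hp hm
  · calc s * (u * Z + v * Y) ≤ s * (c * Y * Z + d * Z * Y) := by gcongr
      _ = s * ((c + d) * (Y * Z)) := by ring
      _ < s * ((k - 1) * (Y * Z)) := by gcongr
      _ = (k * s - s) * (Y * Z) := by ring
      _ ≤ (p - s) * (Y * Z) := by gcongr

theorem discriminant_bound {s p q r : ℝ} (hs : 0 ≤ s) (hp : 0 < p) (hps : 5.82 * s ≤ p)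
    (hpq : p ≤ q) (hqr : q ≤ r) (hsum : p + q + r + s = 16) (hs' : s ≤ 0.46)
    (hlin : 4.806 ≤ 5 / 29 * (p + q) + 5 / 33 * (p + r) + 1 / 7 * (q + r)) :
    0 < q - 3 * s - p / 4 ∧
    s * ((1.25 * r + 5 * s) * (r - 3 * s - p / 4) + (1.25 * q + 5 * s) * (q - 3 * s - p / 4))
      < (p - s) * ((q - 3 * s - p / 4) * (r - 3 * s - p / 4)) := by
  have hY : 0 < q - 3 * s - p / 4 := by linarith
  have hZ : 0 < r - 3 * s - p / 4 := by linarith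
  refine ⟨hY, ?_⟩
  have key : ∀ k c d : ℝ, k * s ≤ p → 1.25 * r + 5 * s ≤ c * (q - 3 * s - p / 4) →
      1.25 * q + 5 * s ≤ d * (r - 3 * s - p / 4) → c + d < k - 1 → _ :=
    fun k c d hk hu hv hcd => mul_add_lt_sub_mul hs hp hk hY hZ hu hv hcd
  rcases le_total p (6.6 * s) with hk | hk
  · rcases le_total q (0.6 * r) with hq | hq
    · exact key 5.82 3.11 0.95 (by linarith) (by linarith) (by linarith) (by norm_num)
    rcases le_total q (0.8 * r) with hq | hq
    · exact key 5.82 2.7 1.5 (by linarith) (by linarith) (by linarith) (by norm_num)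
    exact key 5.82 2.4 2.2 (by linarith) (by linarith) (by linarith) (by norm_num)
  rcases le_total p (8 * s) with hk | hk
  · rcases le_total q (0.6 * r) with hq | hq
    · exact key 6.6 3.11 1.02 (by linarith) (by linarith) (by linarith) (by norm_num)
    rcases le_total q (0.8 * r) with hq | hq
    · exact key 6.6 2.95 1.72 (by linarith) (by linarith) (by linarith) (by norm_num)
    exact key 6.6 2.83 2.68 (by linarith) (by linarith) (by linarith) (by norm_num)
  rcases le_total p (8.8 * s) with hk | hk
  · exact key 8 3.4 2.9 (by linarith) (by linarith) (by linarith) (by norm_num)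
  rcases le_total p (10 * s) with hk | hk
  · rcases le_total q (0.6 * r) with hq | hq
    · exact key 8.8 4.3 1.4 (by linarith) (by linarith) (by linarith) (by norm_num)
    rcases le_total q (0.8 * r) with hq | hq
    · exact key 8.8 5.1 2.4 (by linarith) (by linarith) (by linarith) (by norm_num)
    exact key 8.8 4.3 3.2 (by linarith) (by linarith) (by linarith) (by norm_num)
  rcases le_total p (15 * s) with hk | hk
  · rcases le_total q (0.4 * r) with hq | hq
    · exact key 10 7.6 0.82 (by linarith) (by linarith) (by linarith) (by norm_num)
    rcases le_total q (0.6 * r) with hq | hq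
    · exact key 10 6.9 1.6 (by linarith) (by linarith) (by linarith) (by norm_num)
    exact key 10 5.49 3.505 (by linarith) (by linarith) (by linarith) (by norm_num)
  exact key 15 10.8 2.9 (by linarith) (by linarith) (by linarith) (by norm_num)

/-- Three vectors of the plane are linearly dependent. -/
theorem exists_planar_relation (a b c a' b' c' : ℝ) :
    ∃ x y z : ℝ, (x ≠ 0 ∨ y ≠ 0 ∨ z ≠ 0) ∧ x * a + y * b + z * c = 0 ∧
      x * a' + y * b' + z * c' = 0 := by
  have hdet : (!![a, b, c; a', b', c'; 0, 0, 0] : Matrix (Fin 3) (Fin 3) ℝ).det = 0 := by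
    simp [Matrix.det_fin_three]
  obtain ⟨v, hv, h⟩ := Matrix.exists_mulVec_eq_zero_iff.mpr hdet
  refine ⟨v 0, v 1, v 2, ?_, ?_, ?_⟩
  · by_contra! hc
    exact hv (by ext i; fin_cases i <;> simp [hc])
  · have := congrFun h 0
    simp [Matrix.mulVec, dotProduct, Fin.sum_univ_three] at this
    linarith
  · have := congrFun h 1
    simp [Matrix.mulVec, dotProduct, Fin.sum_univ_three] at this
    linarith

theorem abs_dot_le_sqrt {x₁ x₂ x₃ y₁ y₂ y₃ s r : ℝ} (hs : x₁ ^ 2 + x₂ ^ 2 + x₃ ^ 2 = s)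
    (hr : y₁ ^ 2 + y₂ ^ 2 + y₃ ^ 2 = r) : |x₁ * y₁ + x₂ * y₂ + x₃ * y₃| ≤ √(s * r) := by
  apply Real.abs_le_sqrt
  subst hs hr
  nlinarith [sq_nonneg (x₁ * y₂ - x₂ * y₁), sq_nonneg (x₁ * y₃ - x₃ * y₁),
    sq_nonneg (x₂ * y₃ - x₃ * y₂)]

theorem eq_zero_of_quadratic_le {s p q r x y z : ℝ} (hs : 0 ≤ s) (hp : 0 ≤ p)
    (hqr : q ≤ r) (hq : 0 ≤ q) (hx : 0 ≤ x) (hy : 0 ≤ y) (hz : 0 ≤ z)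
    (hY : 0 < q - 3 * s - p / 4)
    (hdisc : s * ((1.25 * r + 5 * s) * (r - 3 * s - p / 4)
        + (1.25 * q + 5 * s) * (q - 3 * s - p / 4))
      < (p - s) * ((q - 3 * s - p / 4) * (r - 3 * s - p / 4)))
    (h : p * x ^ 2 + q * y ^ 2 + r * z ^ 2 ≤ s * (x + y + z) ^ 2
      + 2 * (√(s * r) * (x * y) + √(s * q) * (x * z) + √(s * p) * (y * z))) :
    x = 0 ∧ y = 0 ∧ z = 0 := by
  have hr : 0 ≤ r := hq.trans hqr
  have hA : √(s * p) ≤ s + p / 4 := by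
    apply Real.sqrt_le_iff.mpr ⟨by linarith, ?_⟩
    nlinarith [sq_nonneg (s - p / 4)]
  have key : ∀ t : ℝ, 0 ≤ t → (√(s * t) + s) ^ 2 ≤ s * (1.25 * t + 5 * s) := by
    intro t ht
    have h1 : √(s * t) ≤ t / 8 + 2 * s := by
      apply Real.sqrt_le_iff.mpr ⟨by linarith, ?_⟩
      nlinarith [sq_nonneg (t / 8 - 2 * s)]
    nlinarith [Real.sq_sqrt (mul_nonneg hs ht)]
  have hB := key q hq
  have hC := key r hr
  set A := √(s * p)
  set B := √(s * q) + s with hBdef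
  set C := √(s * r) + s with hCdef
  have hZ : 0 < r - 3 * s - p / 4 := by linarith
  set Y := q - 3 * s - p / 4 with hYdef
  set Z := r - 3 * s - p / 4 with hZdef
  have h1 : (A + s) * (2 * (y * z)) ≤ (2 * s + p / 4) * (y ^ 2 + z ^ 2) := by
    have := two_mul_le_add_sq y z
    calc (A + s) * (2 * (y * z)) ≤ (2 * s + p / 4) * (2 * (y * z)) := by
          apply mul_le_mul_of_nonneg_right (by linarith) (by positivity)
      _ ≤ _ := mul_le_mul_of_nonneg_left (by linarith) (by linarith)
  have h2 : (p - s) * x ^ 2 + Y * y ^ 2 + Z * z ^ 2 ≤ 2 * C * (x * y) + 2 * B * (x * z) := by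
    rw [hYdef, hZdef, hBdef, hCdef]
    linarith
  have h3 : C ^ 2 * Z + B ^ 2 * Y < (p - s) * (Y * Z) := by
    have := mul_le_mul_of_nonneg_right hC hZ.le
    have := mul_le_mul_of_nonneg_right hB hY.le
    linarith
  have hx0 : x = 0 := by
    by_contra hx0
    have hx2 : 0 < x ^ 2 := by positivity
    have h4 := mul_lt_mul_of_pos_right h3 hx2
    have h5 := mul_le_mul_of_nonneg_left h2 (mul_pos hY hZ).le
    have h6 : 0 ≤ Z * (Y * y - C * x) ^ 2 := by positivity
    have h7 : 0 ≤ Y * (Z * z - B * x) ^ 2 := by positivity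
    linarith
  subst hx0
  have hy2 : 0 ≤ Y * y ^ 2 := by positivity
  have hz2 : 0 ≤ Z * z ^ 2 := by positivity
  have hy0 : Y * y ^ 2 = 0 := by linarith
  have hz0 : Z * z ^ 2 = 0 := by linarith
  simpa [hY.ne', hZ.ne'] using And.intro hy0 hz0

/-- If `S`, `P`, `Q`, `R` are the signed sums of four vectors of equal length in the upper
half-space, the vertical coordinates of `P`, `Q`, `R` are bounded by that of `S`, and their
mutual inner products are governed by `S`; so they cannot be nearly orthogonal and long. -/
theorem false_of_signed_sums {S₁ S₂ S₃ P₁ P₂ P₃ Q₁ Q₂ Q₃ R₁ R₂ R₃ s p q r : ℝ}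
    (hs : S₁ ^ 2 + S₂ ^ 2 + S₃ ^ 2 = s) (hp : P₁ ^ 2 + P₂ ^ 2 + P₃ ^ 2 = p)
    (hq : Q₁ ^ 2 + Q₂ ^ 2 + Q₃ ^ 2 = q) (hr : R₁ ^ 2 + R₂ ^ 2 + R₃ ^ 2 = r)
    (hPQ : P₁ * Q₁ + P₂ * Q₂ + P₃ * Q₃ = -(S₁ * R₁ + S₂ * R₂ + S₃ * R₃))
    (hPR : P₁ * R₁ + P₂ * R₂ + P₃ * R₃ = -(S₁ * Q₁ + S₂ * Q₂ + S₃ * Q₃))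
    (hQR : Q₁ * R₁ + Q₂ * R₂ + Q₃ * R₃ = -(S₁ * P₁ + S₂ * P₂ + S₃ * P₃))
    (hP₃ : |P₃| ≤ S₃) (hQ₃ : |Q₃| ≤ S₃) (hR₃ : |R₃| ≤ S₃) (hqr : q ≤ r)
    (hY : 0 < q - 3 * s - p / 4)
    (hdisc : s * ((1.25 * r + 5 * s) * (r - 3 * s - p / 4)
        + (1.25 * q + 5 * s) * (q - 3 * s - p / 4))
      < (p - s) * ((q - 3 * s - p / 4) * (r - 3 * s - p / 4))) : False := by
  obtain ⟨x, y, z, hne, h₁, h₂⟩ := exists_planar_relation P₁ Q₁ R₁ P₂ Q₂ R₂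
  have hs0 : 0 ≤ s := by rw [← hs]; positivity
  have hp0 : 0 ≤ p := by rw [← hp]; positivity
  have hq0 : 0 ≤ q := by rw [← hq]; positivity
  have hnorm : p * x ^ 2 + q * y ^ 2 + r * z ^ 2
      = (x * P₃ + y * Q₃ + z * R₃) ^ 2 + 2 * ((S₁ * R₁ + S₂ * R₂ + S₃ * R₃) * (x * y)
        + (S₁ * Q₁ + S₂ * Q₂ + S₃ * Q₃) * (x * z) + (S₁ * P₁ + S₂ * P₂ + S₃ * P₃) * (y * z)) := by
    subst hp hq hr
    linear_combination (x * P₁ + y * Q₁ + z * R₁) * h₁ + (x * P₂ + y * Q₂ + z * R₂) * h₂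
      - 2 * x * y * hPQ - 2 * x * z * hPR - 2 * y * z * hQR
  have hvert : (x * P₃ + y * Q₃ + z * R₃) ^ 2 ≤ s * (|x| + |y| + |z|) ^ 2 := by
    have habs : |x * P₃ + y * Q₃ + z * R₃| ≤ S₃ * (|x| + |y| + |z|) := by
      calc |x * P₃ + y * Q₃ + z * R₃| ≤ |x * P₃| + |y * Q₃| + |z * R₃| := abs_add_three _ _ _
        _ = |x| * |P₃| + |y| * |Q₃| + |z| * |R₃| := by simp only [abs_mul]
        _ ≤ |x| * S₃ + |y| * S₃ + |z| * S₃ := by gcongr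
        _ = _ := by ring
    calc (x * P₃ + y * Q₃ + z * R₃) ^ 2 ≤ (S₃ * (|x| + |y| + |z|)) ^ 2 := by
          rw [← sq_abs]; gcongr
      _ = S₃ ^ 2 * (|x| + |y| + |z|) ^ 2 := by ring
      _ ≤ _ := by gcongr; nlinarith [sq_nonneg S₁, sq_nonneg S₂]
  have hmul : ∀ {d e a b : ℝ}, |d| ≤ e → d * (a * b) ≤ e * (|a| * |b|) := by
    intro d e a b hde
    calc d * (a * b) ≤ |d * (a * b)| := le_abs_self _
      _ = |d| * (|a| * |b|) := by simp only [abs_mul]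
      _ ≤ _ := by gcongr
  have hxy := hmul (a := x) (b := y) (abs_dot_le_sqrt hs hr)
  have hxz := hmul (a := x) (b := z) (abs_dot_le_sqrt hs hq)
  have hyz := hmul (a := y) (b := z) (abs_dot_le_sqrt hs hp)
  obtain ⟨hx, hy, hz⟩ := eq_zero_of_quadratic_le hs0 hp0 hqr hq0 (abs_nonneg x) (abs_nonneg y)
    (abs_nonneg z) hY hdisc (by simp only [sq_abs] at hvert ⊢; linarith)
  simp only [abs_eq_zero] at hx hy hz
  tauto

theorem sum_sqrt_le_of_signed_sums_sorted {S₁ S₂ S₃ P₁ P₂ P₃ Q₁ Q₂ Q₃ R₁ R₂ R₃ s p q r : ℝ}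
    (hs : S₁ ^ 2 + S₂ ^ 2 + S₃ ^ 2 = s) (hp : P₁ ^ 2 + P₂ ^ 2 + P₃ ^ 2 = p)
    (hq : Q₁ ^ 2 + Q₂ ^ 2 + Q₃ ^ 2 = q) (hr : R₁ ^ 2 + R₂ ^ 2 + R₃ ^ 2 = r)
    (hPQ : P₁ * Q₁ + P₂ * Q₂ + P₃ * Q₃ = -(S₁ * R₁ + S₂ * R₂ + S₃ * R₃))
    (hPR : P₁ * R₁ + P₂ * R₂ + P₃ * R₃ = -(S₁ * Q₁ + S₂ * Q₂ + S₃ * Q₃))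
    (hQR : Q₁ * R₁ + Q₂ * R₂ + Q₃ * R₃ = -(S₁ * P₁ + S₂ * P₂ + S₃ * P₃))
    (hP₃ : |P₃| ≤ S₃) (hQ₃ : |Q₃| ≤ S₃) (hR₃ : |R₃| ≤ S₃)
    (hsum : p + q + r + s = 16) (hpq : p ≤ q) (hqr : q ≤ r) :
    √(p + q) + √(p + r) + √(q + r) ≤ 4 + 4 * √2 := by
  have hs0 : 0 ≤ s := by rw [← hs]; positivity
  have hp0 : 0 ≤ p := by rw [← hp]; positivity
  have h2 : √2 ^ 2 = 2 := Real.sq_sqrt (by norm_num)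
  have h2lo : 1.4142 < √2 := Real.lt_sqrt_of_sq_lt (by norm_num)
  rcases le_or_gt p ((3 + 2 * √2) * s) with h | h
  · have t₁ := sqrt_le_tangent (x := p + q) (2 * √2) (√2 / 8) (by positivity)
      (by linear_combination h2 / 2) (by linarith)
    have t₂ := sqrt_le_tangent (x := p + r) (2 * √2) (√2 / 8) (by positivity)
      (by linear_combination h2 / 2) (by linarith)
    have t₃ := sqrt_le_tangent (x := q + r) 4 (1 / 8) (by norm_num) (by norm_num) (by linarith)
    have : (√2 - 1) * p ≤ (√2 + 1) * s := by
      calc (√2 - 1) * p ≤ (√2 - 1) * ((3 + 2 * √2) * s) := by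
            gcongr; linarith
        _ = (√2 + 1) * s := by linear_combination 2 * s * h2
    obtain rfl : r = 16 - s - p - q := by linarith
    linarith
  · by_contra! hlt
    have t₁ := sqrt_le_tangent (x := p + q) 2.9 (5 / 29) (by norm_num) (by norm_num) (by linarith)
    have t₂ := sqrt_le_tangent (x := p + r) 3.3 (5 / 33) (by norm_num) (by norm_num) (by linarith)
    have t₃ := sqrt_le_tangent (x := q + r) 3.5 (1 / 7) (by norm_num) (by norm_num) (by linarith)
    have u₁ := sqrt_le_tangent (x := p + q) 3.22 (25 / 161) (by norm_num) (by norm_num)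
      (by linarith)
    have u₂ := sqrt_le_tangent (x := p + r) 3.22 (25 / 161) (by norm_num) (by norm_num)
      (by linarith)
    have u₃ := sqrt_le_tangent (x := q + r) 3.22 (25 / 161) (by norm_num) (by norm_num)
      (by linarith)
    have hps : 5.82 * s ≤ p := by
      have := mul_le_mul_of_nonneg_right h2lo.le hs0
      linarith only [this, h, hs0]
    obtain ⟨hY, hdisc⟩ := discriminant_bound hs0 (lt_of_le_of_lt (by positivity) h) hps hpq hqr
      hsum (by linarith only [hlt, h2lo, hsum, u₁, u₂, u₃])
      (by linarith only [hlt, h2lo, t₁, t₂, t₃])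
    exact false_of_signed_sums hs hp hq hr hPQ hPR hQR hP₃ hQ₃ hR₃ hqr hY hdisc

theorem sum_sqrt_le_of_signed_sums {S₁ S₂ S₃ P₁ P₂ P₃ Q₁ Q₂ Q₃ R₁ R₂ R₃ s p q r : ℝ}
    (hs : S₁ ^ 2 + S₂ ^ 2 + S₃ ^ 2 = s) (hp : P₁ ^ 2 + P₂ ^ 2 + P₃ ^ 2 = p)
    (hq : Q₁ ^ 2 + Q₂ ^ 2 + Q₃ ^ 2 = q) (hr : R₁ ^ 2 + R₂ ^ 2 + R₃ ^ 2 = r)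
    (hPQ : P₁ * Q₁ + P₂ * Q₂ + P₃ * Q₃ = -(S₁ * R₁ + S₂ * R₂ + S₃ * R₃))
    (hPR : P₁ * R₁ + P₂ * R₂ + P₃ * R₃ = -(S₁ * Q₁ + S₂ * Q₂ + S₃ * Q₃))
    (hQR : Q₁ * R₁ + Q₂ * R₂ + Q₃ * R₃ = -(S₁ * P₁ + S₂ * P₂ + S₃ * P₃))
    (hP₃ : |P₃| ≤ S₃) (hQ₃ : |Q₃| ≤ S₃) (hR₃ : |R₃| ≤ S₃)
    (hsum : p + q + r + s = 16) :
    √(p + q) + √(p + r) + √(q + r) ≤ 4 + 4 * √2 := by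
  have hQP : Q₁ * P₁ + Q₂ * P₂ + Q₃ * P₃ = -(S₁ * R₁ + S₂ * R₂ + S₃ * R₃) := by linarith
  have hRP : R₁ * P₁ + R₂ * P₂ + R₃ * P₃ = -(S₁ * Q₁ + S₂ * Q₂ + S₃ * Q₃) := by linarith
  have hRQ : R₁ * Q₁ + R₂ * Q₂ + R₃ * Q₃ = -(S₁ * P₁ + S₂ * P₂ + S₃ * P₃) := by linarith
  have e₁ := add_comm p q
  have e₂ := add_comm p r
  have e₃ := add_comm q r
  rcases le_total p q with hpq | hpq <;> rcases le_total q r with hqr | hqr <;>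
    rcases le_total p r with hpr | hpr
  · exact sum_sqrt_le_of_signed_sums_sorted hs hp hq hr hPQ hPR hQR hP₃ hQ₃ hR₃ hsum hpq hqr
  · exact sum_sqrt_le_of_signed_sums_sorted hs hp hq hr hPQ hPR hQR hP₃ hQ₃ hR₃ hsum hpq hqr
  · have := sum_sqrt_le_of_signed_sums_sorted hs hp hr hq hPR hPQ hRQ hP₃ hR₃ hQ₃
      (by linarith) hpr hqr
    rw [e₃]; linarith
  · have := sum_sqrt_le_of_signed_sums_sorted hs hr hp hq hRP hRQ hPQ hR₃ hP₃ hQ₃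
      (by linarith) hpr hpq
    rw [e₂, e₃]; linarith
  · have := sum_sqrt_le_of_signed_sums_sorted hs hq hp hr hQP hQR hPR hQ₃ hP₃ hR₃
      (by linarith) hpq hpr
    rw [e₁]; linarith
  · have := sum_sqrt_le_of_signed_sums_sorted hs hq hr hp hQR hQP hRP hQ₃ hR₃ hP₃
      (by linarith) hqr hpr
    rw [e₁, e₂]; linarith
  · have := sum_sqrt_le_of_signed_sums_sorted hs hr hq hp hRQ hRP hQP hR₃ hQ₃ hP₃
      (by linarith) hqr hpq
    rw [e₁, e₂, e₃]; linarith
  · have := sum_sqrt_le_of_signed_sums_sorted hs hr hq hp hRQ hRP hQP hR₃ hQ₃ hP₃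
      (by linarith) hqr hpq
    rw [e₁, e₂, e₃]; linarith

theorem sum_dist_le_of_mem_upperHemisphere
    (A B C D : ℝ × ℝ × ℝ)
    (hA : A ∈ upperHemisphere) (hB : B ∈ upperHemisphere)
    (hC : C ∈ upperHemisphere) (hD : D ∈ upperHemisphere) :
    dist3 A B + dist3 A C + dist3 A D + dist3 B C + dist3 B D + dist3 C D
      ≤ 4 + 4 * Real.sqrt 2 := by
  obtain ⟨a₁, a₂, a₃⟩ := A
  obtain ⟨b₁, b₂, b₃⟩ := B
  obtain ⟨c₁, c₂, c₃⟩ := C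
  obtain ⟨d₁, d₂, d₃⟩ := D
  obtain ⟨hA, hA₃⟩ := hA
  obtain ⟨hB, hB₃⟩ := hB
  obtain ⟨hC, hC₃⟩ := hC
  obtain ⟨hD, hD₃⟩ := hD
  dsimp only at hA hB hC hD hA₃ hB₃ hC₃ hD₃
  have main := sum_sqrt_le_of_signed_sums
    (S₁ := a₁ + b₁ + c₁ + d₁) (S₂ := a₂ + b₂ + c₂ + d₂) (S₃ := a₃ + b₃ + c₃ + d₃)
    (P₁ := a₁ + c₁ - b₁ - d₁) (P₂ := a₂ + c₂ - b₂ - d₂) (P₃ := a₃ + c₃ - b₃ - d₃)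
    (Q₁ := a₁ + b₁ - c₁ - d₁) (Q₂ := a₂ + b₂ - c₂ - d₂) (Q₃ := a₃ + b₃ - c₃ - d₃)
    (R₁ := a₁ + d₁ - b₁ - c₁) (R₂ := a₂ + d₂ - b₂ - c₂) (R₃ := a₃ + d₃ - b₃ - c₃)
    rfl rfl rfl rfl
    (by linear_combination 2 * (hA - hB - hC + hD))
    (by linear_combination 2 * (hA + hB - hC - hD))
    (by linear_combination 2 * (hA - hB + hC - hD))
    (abs_le.mpr ⟨by linarith, by linarith⟩) (abs_le.mpr ⟨by linarith, by linarith⟩)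
    (abs_le.mpr ⟨by linarith, by linarith⟩)
    (by linear_combination 4 * (hA + hB + hC + hD))
  refine le_trans ?_ main
  have hAD := sqrt_add_sqrt_le (x := (a₁ - d₁) ^ 2 + (a₂ - d₂) ^ 2 + (a₃ - d₃) ^ 2)
    (y := (b₁ - c₁) ^ 2 + (b₂ - c₂) ^ 2 + (b₃ - c₃) ^ 2) (by positivity) (by positivity) rfl
  have hAB := sqrt_add_sqrt_le (x := (a₁ - b₁) ^ 2 + (a₂ - b₂) ^ 2 + (a₃ - b₃) ^ 2)
    (y := (c₁ - d₁) ^ 2 + (c₂ - d₂) ^ 2 + (c₃ - d₃) ^ 2) (by positivity) (by positivity) rfl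
  have hAC := sqrt_add_sqrt_le (x := (a₁ - c₁) ^ 2 + (a₂ - c₂) ^ 2 + (a₃ - c₃) ^ 2)
    (y := (b₁ - d₁) ^ 2 + (b₂ - d₂) ^ 2 + (b₃ - d₃) ^ 2) (by positivity) (by positivity) rfl
  simp only [dist3]
  ring_nf at hAD hAB hAC ⊢
  linarith
end

section
/- The four points A = (0,−1,0), B = (1,0,0), C = (−1,0,0), D = (0,1,0) lie on the closed unit upper hemisphere S²_{≥0} = {(x,y,z) ∈ ℝ³ : x² + y² + z² = 1, z ≥ 0} and the sum of their six pairwise Euclidean distances equals 4 + 4√2; consequently, the maximum over all quadruples of points of S²_{≥0} of the sum of the six pairwise distances equals exactly 4 + 4√2. -/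
/-- Sum of the six pairwise distances of a quadruple. -/
noncomputable def sumDist (A B C D : ℝ × ℝ × ℝ) : ℝ :=
  dist3 A B + dist3 A C + dist3 A D + dist3 B C + dist3 B D + dist3 C D

/-- Standard inner product on `ℝ × ℝ × ℝ`. -/
def dot3 (P Q : ℝ × ℝ × ℝ) : ℝ := P.1 * Q.1 + P.2.1 * Q.2.1 + P.2.2 * Q.2.2

lemma dist3_comm (P Q : ℝ × ℝ × ℝ) : dist3 P Q = dist3 Q P := by
  unfold dist3
  congr 1
  ring

lemma dist3_self (P : ℝ × ℝ × ℝ) : dist3 P P = 0 := by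
  simp [dist3]

lemma dist3_nonneg (P Q : ℝ × ℝ × ℝ) : 0 ≤ dist3 P Q := Real.sqrt_nonneg _

lemma dot3_self_of_mem {P : ℝ × ℝ × ℝ} (hP : P ∈ upperHemisphere) : dot3 P P = 1 := by
  have h := hP.1
  unfold dot3
  linarith

lemma dist3_eq_sqrt_dot3 {P Q : ℝ × ℝ × ℝ} (hP : dot3 P P = 1) (hQ : dot3 Q Q = 1) :
    dist3 P Q = Real.sqrt (2 - 2 * dot3 P Q) := by
  unfold dist3
  unfold dot3 at *
  congr 1
  linarith

lemma dist3_sq {P Q : ℝ × ℝ × ℝ} (hP : dot3 P P = 1) (hQ : dot3 Q Q = 1) :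
    dist3 P Q ^ 2 = 2 - 2 * dot3 P Q := by
  unfold dist3
  rw [Real.sq_sqrt (by positivity)]
  unfold dot3 at *
  linarith

lemma dist3_pos {P Q : ℝ × ℝ × ℝ} (h : P ≠ Q) : 0 < dist3 P Q := by
  refine Real.sqrt_pos.2 ?_
  by_contra hle
  apply h
  have h1 := sq_nonneg (P.1 - Q.1)
  have h2 := sq_nonneg (P.2.1 - Q.2.1)
  have h3 := sq_nonneg (P.2.2 - Q.2.2)
  have e1 : P.1 - Q.1 = 0 := pow_eq_zero_iff (two_ne_zero) |>.1 (by linarith)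
  have e2 : P.2.1 - Q.2.1 = 0 := pow_eq_zero_iff (two_ne_zero) |>.1 (by linarith)
  have e3 : P.2.2 - Q.2.2 = 0 := pow_eq_zero_iff (two_ne_zero) |>.1 (by linarith)
  ext <;> linarith

lemma dist3_le_two {P Q : ℝ × ℝ × ℝ} (hP : dot3 P P = 1) (hQ : dot3 Q Q = 1) :
    dist3 P Q ≤ 2 := by
  have h := dist3_sq hP hQ
  have h' : -1 ≤ dot3 P Q := by
    unfold dot3 at *
    nlinarith [sq_nonneg (P.1 + Q.1), sq_nonneg (P.2.1 + Q.2.1), sq_nonneg (P.2.2 + Q.2.2)]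
  nlinarith [dist3_nonneg P Q]

lemma sumDist_perm (A B C D : ℝ × ℝ × ℝ) :
    sumDist B A C D = sumDist A B C D ∧ sumDist A C B D = sumDist A B C D ∧
      sumDist A B D C = sumDist A B C D := by
  unfold sumDist
  rw [dist3_comm B A, dist3_comm C B, dist3_comm D C]
  refine ⟨?_, ?_, ?_⟩ <;> ring

/-! ### Points on a great circle -/

lemma sum_sin_sorted {α β γ δ : ℝ} (h₁ : α ≤ β) (h₂ : β ≤ γ) (h₃ : γ ≤ δ) (h₄ : δ ≤ α + Real.pi) :
    |Real.sin (α - β)| + |Real.sin (α - γ)| + |Real.sin (α - δ)| + |Real.sin (β - γ)|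
      + |Real.sin (β - δ)| + |Real.sin (γ - δ)| ≤ 2 + 2 * Real.sqrt 2 := by
  have key : ∀ x y : ℝ, x ≤ y → y ≤ x + Real.pi → |Real.sin (x - y)| = Real.sin (y - x) := by
    intro x y h h'
    rw [← neg_sub, Real.sin_neg, abs_neg, abs_of_nonneg]
    exact Real.sin_nonneg_of_nonneg_of_le_pi (by linarith) (by linarith)
  rw [key α β h₁ (by linarith), key α δ (by linarith) (by linarith),
    key β γ h₂ (by linarith), key γ δ h₃ (by linarith)]
  have d₁ := Real.abs_sin_le_one (α - γ)
  have d₂ := Real.abs_sin_le_one (β - δ)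
  set s := (γ - α) / 2 with hs
  set t := (β - (α + γ) / 2) with ht
  set r := (δ - (α + γ) / 2) with hr
  have e₁ : Real.sin (β - α) + Real.sin (γ - β) = 2 * Real.sin s * Real.cos t := by
    rw [show β - α = s + t by rw [hs, ht]; ring, show γ - β = s - t by rw [hs, ht]; ring,
      Real.sin_add s t, Real.sin_sub s t]
    ring
  have e₂ : Real.sin (γ - δ + 2 * (δ - γ)) + Real.sin (δ - α) = 2 * Real.sin r * Real.cos s := by
    rw [show γ - δ + 2 * (δ - γ) = r - s by rw [hs, hr]; ring,
      show δ - α = r + s by rw [hs, hr]; ring, Real.sin_add r s, Real.sin_sub r s]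
    ring
  rw [show γ - δ + 2 * (δ - γ) = δ - γ by ring] at e₂
  have hs₀ : 0 ≤ Real.sin s := Real.sin_nonneg_of_nonneg_of_le_pi (by linarith) (by linarith)
  have hc₀ : 0 ≤ Real.cos s := Real.cos_nonneg_of_neg_pi_div_two_le_of_le (by linarith) (by linarith)
  have b₁ : Real.sin s * Real.cos t ≤ Real.sin s := mul_le_of_le_one_right hs₀ (Real.cos_le_one t)
  have b₂ : Real.sin r * Real.cos s ≤ Real.cos s := mul_le_of_le_one_left hc₀ (Real.sin_le_one r)
  have b₃ : Real.sin s + Real.cos s ≤ Real.sqrt 2 := by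
    apply Real.le_sqrt_of_sq_le
    nlinarith [Real.sin_sq_add_cos_sq s, sq_nonneg (Real.sin s - Real.cos s)]
  linarith

lemma sum_abs_sin_le {α β γ δ : ℝ} (hα : α ∈ Set.Icc 0 Real.pi) (hβ : β ∈ Set.Icc 0 Real.pi)
    (hγ : γ ∈ Set.Icc 0 Real.pi) (hδ : δ ∈ Set.Icc 0 Real.pi) :
    |Real.sin (α - β)| + |Real.sin (α - γ)| + |Real.sin (α - δ)| + |Real.sin (β - γ)|
      + |Real.sin (β - δ)| + |Real.sin (γ - δ)| ≤ 2 + 2 * Real.sqrt 2 := by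
  have symm : ∀ x y : ℝ, |Real.sin (x - y)| = |Real.sin (y - x)| := fun x y => by
    rw [← neg_sub, Real.sin_neg, abs_neg]
  obtain ⟨a₀, a₁⟩ := hα
  obtain ⟨b₀, b₁⟩ := hβ
  obtain ⟨c₀, c₁⟩ := hγ
  obtain ⟨d₀, d₁⟩ := hδ
  wlog h₁ : α ≤ β generalizing α β
  · have := this b₀ b₁ a₀ a₁ (by linarith)
    rw [symm β α] at this
    linarith
  wlog h₂ : γ ≤ δ generalizing γ δ
  · have := this d₀ d₁ c₀ c₁ (by linarith)
    rw [symm δ γ] at this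
    linarith
  wlog h₃ : α ≤ γ generalizing α β γ δ
  · have := this c₀ c₁ d₀ d₁ h₂ a₀ a₁ b₀ b₁ h₁ (by linarith)
    rw [symm γ α, symm γ β, symm δ α, symm δ β] at this
    linarith
  rcases le_total β γ with h₄ | h₄
  · exact sum_sin_sorted h₁ h₄ h₂ (by linarith)
  · rcases le_total β δ with h₅ | h₅
    · have := sum_sin_sorted h₃ h₄ h₅ (by linarith)
      rw [symm γ β] at this
      linarith
    · have := sum_sin_sorted h₃ h₂ h₅ (by linarith)
      rw [symm γ β, symm δ β] at this
      linarith

lemma exists_half_angle {x y : ℝ} (h : x ^ 2 + y ^ 2 = 1) :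
    ∃ φ ∈ Set.Icc 0 Real.pi, x = Real.cos (2 * φ) ∧ y = Real.sin (2 * φ) := by
  have key : ∃ θ ∈ Set.Icc (-Real.pi) Real.pi, -x = Real.cos θ ∧ -y = Real.sin θ := by
    refine ⟨Complex.arg ⟨-x, -y⟩, ⟨(Complex.neg_pi_lt_arg _).le, Complex.arg_le_pi _⟩, ?_, ?_⟩
    · have hn : ‖(⟨-x, -y⟩ : ℂ)‖ = 1 := by
        rw [Complex.norm_eq_sqrt_sq_add_sq]; simp [h]
      rw [Complex.cos_arg (by rw [← norm_pos_iff, hn]; exact one_pos), hn]; simp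
    · have hn : ‖(⟨-x, -y⟩ : ℂ)‖ = 1 := by
        rw [Complex.norm_eq_sqrt_sq_add_sq]; simp [h]
      rw [Complex.sin_arg, hn]; simp
  obtain ⟨θ, ⟨h₀, h₁⟩, hx, hy⟩ := key
  refine ⟨(θ + Real.pi) / 2, ⟨by linarith, by linarith⟩, ?_, ?_⟩
  · rw [mul_div_cancel₀ _ (two_ne_zero), Real.cos_add_pi]; linarith
  · rw [mul_div_cancel₀ _ (two_ne_zero), Real.sin_add_pi]; linarith

lemma sumDist_le_of_great_circle {U V A B C D : ℝ × ℝ × ℝ}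
    (hU : dot3 U U = 1) (hV : dot3 V V = 1) (hUV : dot3 U V = 0)
    (hA : dot3 A A = 1) (hB : dot3 B B = 1) (hC : dot3 C C = 1) (hD : dot3 D D = 1)
    (pA : ∃ x y : ℝ, A = x • U + y • V) (pB : ∃ x y : ℝ, B = x • U + y • V)
    (pC : ∃ x y : ℝ, C = x • U + y • V) (pD : ∃ x y : ℝ, D = x • U + y • V) :
    sumDist A B C D ≤ 4 + 4 * Real.sqrt 2 := by
  have expand : ∀ x y x' y' : ℝ,
      dot3 (x • U + y • V) (x' • U + y' • V) = x * x' + y * y' := by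
    intro x y x' y'
    simp only [dot3, Prod.fst_add, Prod.snd_add, Prod.smul_fst, Prod.smul_snd, smul_eq_mul] at *
    linear_combination (x * x') * hU + (y * y') * hV + (x * y' + x' * y) * hUV
  have param : ∀ P : ℝ × ℝ × ℝ, dot3 P P = 1 → (∃ x y : ℝ, P = x • U + y • V) →
      ∃ φ ∈ Set.Icc 0 Real.pi, P = Real.cos (2 * φ) • U + Real.sin (2 * φ) • V := by
    rintro P hP ⟨x, y, rfl⟩
    rw [expand] at hP
    obtain ⟨φ, hφ, rfl, rfl⟩ := exists_half_angle (x := x) (y := y) (by linarith)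
    exact ⟨φ, hφ, rfl⟩
  obtain ⟨α, hα, eA⟩ := param A hA pA
  obtain ⟨β, hβ, eB⟩ := param B hB pB
  obtain ⟨γ, hγ, eC⟩ := param C hC pC
  obtain ⟨δ, hδ, eD⟩ := param D hD pD
  have chord : ∀ (P Q : ℝ × ℝ × ℝ) (φ ψ : ℝ), dot3 P P = 1 → dot3 Q Q = 1 →
      P = Real.cos (2 * φ) • U + Real.sin (2 * φ) • V →
      Q = Real.cos (2 * ψ) • U + Real.sin (2 * ψ) • V →
      dist3 P Q = 2 * |Real.sin (φ - ψ)| := by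
    intro P Q φ ψ hP hQ eP eQ
    rw [dist3_eq_sqrt_dot3 hP hQ, eP, eQ, expand, ← Real.cos_sub,
      show 2 * φ - 2 * ψ = 2 * (φ - ψ) by ring, Real.cos_two_mul,
      show 2 - 2 * (2 * Real.cos (φ - ψ) ^ 2 - 1) = (2 * Real.sin (φ - ψ)) ^ 2 by
        nlinarith [Real.sin_sq_add_cos_sq (φ - ψ)], Real.sqrt_sq_eq_abs, abs_mul,
      abs_of_pos (two_pos : (0 : ℝ) < 2)]
  have h := sum_abs_sin_le hα hβ hγ hδ
  unfold sumDist
  rw [chord A B α β hA hB eA eB, chord A C α γ hA hC eA eC, chord A D α δ hA hD eA eD,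
    chord B C β γ hB hC eB eC, chord B D β δ hB hD eB eD, chord C D γ δ hC hD eC eD]
  linarith

lemma sumDist_le_of_span {A B C D : ℝ × ℝ × ℝ} (hAD : A ≠ D)
    (hA : dot3 A A = 1) (hB : dot3 B B = 1) (hC : dot3 C C = 1) (hD : dot3 D D = 1)
    (hne : dot3 A D ≠ -1)
    (pB : ∃ x y : ℝ, B = x • A + y • D) (pC : ∃ x y : ℝ, C = x • A + y • D) :
    sumDist A B C D ≤ 4 + 4 * Real.sqrt 2 := by
  set g := dot3 A D with hg
  have hg₁ : g < 1 := by
    have h := pow_pos (dist3_pos hAD) 2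
    rw [dist3_sq hA hD] at h
    linarith
  have hg₂ : -1 < g := by
    refine lt_of_le_of_ne ?_ (Ne.symm hne)
    have h := dist3_le_two hA hD
    have h' := dist3_sq hA hD
    nlinarith [dist3_nonneg A D]
  set k := Real.sqrt (1 - g ^ 2) with hk
  have hpos : 0 < 1 - g ^ 2 := by nlinarith
  have hk₀ : 0 < k := Real.sqrt_pos.2 hpos
  have hk₂ : k ^ 2 = 1 - g ^ 2 := Real.sq_sqrt hpos.le
  set V : ℝ × ℝ × ℝ := k⁻¹ • (D - g • A) with hV
  have eD : D = g • A + k • V := by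
    rw [hV, smul_smul, mul_inv_cancel₀ hk₀.ne', one_smul]
    abel
  have conv : ∀ P : ℝ × ℝ × ℝ, (∃ x y : ℝ, P = x • A + y • D) → ∃ x y : ℝ, P = x • A + y • V := by
    rintro P ⟨x, y, rfl⟩
    refine ⟨x + y * g, y * k, ?_⟩
    conv_lhs => rw [eD]
    module
  refine sumDist_le_of_great_circle (U := A) (V := V) hA ?_ ?_ hA hB hC hD
    ⟨1, 0, by simp⟩ (conv B pB) (conv C pC) ⟨g, k, eD⟩
  · have : dot3 V V = (k⁻¹) ^ 2 * (dot3 D D - 2 * g * dot3 A D + g ^ 2 * dot3 A A) := by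
      simp only [hV, dot3, Prod.fst_sub, Prod.snd_sub, Prod.smul_fst, Prod.smul_snd, smul_eq_mul]
      ring
    rw [this, hA, hD, ← hg, show 1 - 2 * g * g + g ^ 2 * 1 = k ^ 2 by rw [hk₂]; ring]
    field_simp
  · have : dot3 A V = k⁻¹ * (dot3 A D - g * dot3 A A) := by
      simp only [hV, dot3, Prod.fst_sub, Prod.snd_sub, Prod.smul_fst, Prod.smul_snd, smul_eq_mul]
      ring
    rw [this, hA, ← hg]
    ring

/-! ### First-order condition at a maximiser -/

lemma hasDerivAt_dist3_rotation {A D v : ℝ × ℝ × ℝ} (hA : dot3 A A = 1) (hD : dot3 D D = 1)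
    (hv : dot3 v v = 1) (hDv : dot3 D v = 0) (hne : A ≠ D) :
    HasDerivAt (fun t : ℝ => dist3 A (Real.cos t • D + Real.sin t • v))
      (-(dot3 A v / dist3 A D)) 0 := by
  have unit : ∀ t : ℝ, dot3 (Real.cos t • D + Real.sin t • v) (Real.cos t • D + Real.sin t • v)
      = 1 := by
    intro t
    simp only [dot3, Prod.fst_add, Prod.snd_add, Prod.smul_fst, Prod.smul_snd, smul_eq_mul] at *
    linear_combination (Real.cos t) ^ 2 * hD + (Real.sin t) ^ 2 * hv +
      2 * Real.cos t * Real.sin t * hDv + Real.sin_sq_add_cos_sq t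
  have eq : (fun t : ℝ => dist3 A (Real.cos t • D + Real.sin t • v)) =
      fun t : ℝ => Real.sqrt (2 - 2 * (Real.cos t * dot3 A D + Real.sin t * dot3 A v)) := by
    funext t
    rw [dist3_eq_sqrt_dot3 hA (unit t)]
    congr 2
    simp only [dot3, Prod.fst_add, Prod.snd_add, Prod.smul_fst, Prod.smul_snd, smul_eq_mul]
    ring
  have hpos := dist3_pos hne
  have hval : Real.sqrt (2 - 2 * (Real.cos 0 * dot3 A D + Real.sin 0 * dot3 A v)) = dist3 A D := by
    rw [dist3_eq_sqrt_dot3 hA hD]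
    simp
  have hin : HasDerivAt
      (fun t : ℝ => 2 - 2 * (Real.cos t * dot3 A D + Real.sin t * dot3 A v))
      (-(2 * (-Real.sin 0 * dot3 A D + Real.cos 0 * dot3 A v))) 0 :=
    ((((Real.hasDerivAt_cos 0).mul_const _).add
      ((Real.hasDerivAt_sin 0).mul_const _)).const_mul 2).const_sub 2
  rw [eq]
  have h := hin.sqrt (by
    intro h0
    rw [h0, Real.sqrt_zero] at hval
    exact hpos.ne hval)
  rw [hval] at h
  convert h using 1
  simp
  field_simp

lemma critical_of_max {A B C D : ℝ × ℝ × ℝ} (hA : dot3 A A = 1) (hB : dot3 B B = 1)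
    (hC : dot3 C C = 1) (hD : dot3 D D = 1) (hz : 0 < D.2.2)
    (hAD : A ≠ D) (hBD : B ≠ D) (hCD : C ≠ D)
    (hmax : ∀ P ∈ upperHemisphere,
      dist3 A P + dist3 B P + dist3 C P ≤ dist3 A D + dist3 B D + dist3 C D) :
    ∃ μ : ℝ, (dist3 A D)⁻¹ • A + (dist3 B D)⁻¹ • B + (dist3 C D)⁻¹ • C = μ • D := by
  set N := (dist3 A D)⁻¹ • A + (dist3 B D)⁻¹ • B + (dist3 C D)⁻¹ • C with hN
  have orth : ∀ v : ℝ × ℝ × ℝ, dot3 v v = 1 → dot3 D v = 0 → dot3 N v = 0 := by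
    intro v hv hDv
    have hder := ((hasDerivAt_dist3_rotation hA hD hv hDv hAD).add
      (hasDerivAt_dist3_rotation hB hD hv hDv hBD)).add
      (hasDerivAt_dist3_rotation hC hD hv hDv hCD)
    have hloc : IsLocalMax (((fun t : ℝ => dist3 A (Real.cos t • D + Real.sin t • v)) +
        fun t : ℝ => dist3 B (Real.cos t • D + Real.sin t • v)) +
        fun t : ℝ => dist3 C (Real.cos t • D + Real.sin t • v)) 0 := by
      have hcont : Continuous fun t : ℝ => Real.cos t * D.2.2 + Real.sin t * v.2.2 := by fun_prop
      have hev : ∀ᶠ t in nhds (0 : ℝ), 0 < Real.cos t * D.2.2 + Real.sin t * v.2.2 :=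
        hcont.continuousAt.eventually (lt_mem_nhds (by simpa using hz))
      filter_upwards [hev] with t ht
      have := hmax (Real.cos t • D + Real.sin t • v) (by
        refine ⟨?_, by simpa using ht.le⟩
        simp only [dot3, Prod.fst_add, Prod.snd_add, Prod.smul_fst, Prod.smul_snd,
          smul_eq_mul] at *
        linear_combination (Real.cos t) ^ 2 * hD + (Real.sin t) ^ 2 * hv +
          2 * Real.cos t * Real.sin t * hDv + Real.sin_sq_add_cos_sq t)
      simpa using this
    have h0 := hloc.hasDerivAt_eq_zero hder
    have : dot3 N v = dot3 A v / dist3 A D + dot3 B v / dist3 B D + dot3 C v / dist3 C D := by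
      simp only [hN, dot3, Prod.fst_add, Prod.snd_add, Prod.smul_fst, Prod.smul_snd, smul_eq_mul]
      ring
    linarith
  refine ⟨dot3 N D, ?_⟩
  by_contra hne
  set T := N - dot3 N D • D with hT
  have hT₀ : 0 < dot3 T T := by
    have hdist : 0 < dist3 N (dot3 N D • D) := dist3_pos hne
    have h := Real.sqrt_pos.1 hdist
    simp only [hT, dot3, Prod.fst_sub, Prod.snd_sub] at h ⊢
    linarith
  set k := Real.sqrt (dot3 T T) with hk
  have hk₀ : 0 < k := Real.sqrt_pos.2 hT₀
  have hk₂ : k ^ 2 = dot3 T T := Real.sq_sqrt hT₀.le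
  have smul_r : ∀ (P Q : ℝ × ℝ × ℝ) (r : ℝ), dot3 P (r • Q) = r * dot3 P Q := by
    intro P Q r
    simp only [dot3, Prod.smul_fst, Prod.smul_snd, smul_eq_mul]
    ring
  have smul_l : ∀ (P Q : ℝ × ℝ × ℝ) (r : ℝ), dot3 (r • P) Q = r * dot3 P Q := by
    intro P Q r
    simp only [dot3, Prod.smul_fst, Prod.smul_snd, smul_eq_mul]
    ring
  have sub_r : ∀ P Q R : ℝ × ℝ × ℝ, dot3 P (Q - R) = dot3 P Q - dot3 P R := by
    intro P Q R
    simp only [dot3, Prod.fst_sub, Prod.snd_sub]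
    ring
  have hcomm : dot3 D N = dot3 N D := by unfold dot3; ring
  have hDT : dot3 D T = 0 := by
    rw [hT, sub_r, smul_r, hD, hcomm]
    ring
  have hNT : dot3 N T = dot3 T T := by
    have : dot3 T T = dot3 N T - dot3 N D * dot3 D T := by
      simp only [hT, dot3, Prod.fst_sub, Prod.snd_sub, Prod.smul_fst, Prod.smul_snd, smul_eq_mul]
      ring
    rw [this, hDT]
    ring
  have h := orth (k⁻¹ • T) (by
    rw [smul_r, smul_l, ← hk₂]
    field_simp) (by rw [smul_r, hDT, mul_zero])
  rw [smul_r, hNT] at h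
  have : 0 < k⁻¹ * dot3 T T := by positivity
  linarith

/-! ### The three kinds of configurations that can be maximal -/

lemma sumDist_le_of_eq {A B C : ℝ × ℝ × ℝ} (hA : dot3 A A = 1) (hB : dot3 B B = 1)
    (hC : dot3 C C = 1) : sumDist A B C A ≤ 4 + 4 * Real.sqrt 2 := by
  have h₁ := dist3_sq hA hB
  have h₂ := dist3_sq hA hC
  have h₃ := dist3_sq hB hC
  have hs : dist3 A B ^ 2 + dist3 A C ^ 2 + dist3 B C ^ 2 ≤ 9 := by
    rw [h₁, h₂, h₃]
    unfold dot3 at *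
    nlinarith [sq_nonneg (A.1 + B.1 + C.1), sq_nonneg (A.2.1 + B.2.1 + C.2.1),
      sq_nonneg (A.2.2 + B.2.2 + C.2.2)]
  have hle : 5 / 4 ≤ Real.sqrt 2 := Real.le_sqrt_of_sq_le (by norm_num)
  unfold sumDist
  rw [dist3_self, dist3_comm B A, dist3_comm C A]
  nlinarith [sq_nonneg (dist3 A B - 2), sq_nonneg (dist3 A C - 2), sq_nonneg (dist3 B C - 1)]

lemma sumDist_le_of_two_off_equator {A B C D : ℝ × ℝ × ℝ} (hA : A ∈ upperHemisphere)
    (hB : B ∈ upperHemisphere) (hC : C ∈ upperHemisphere) (hD : D ∈ upperHemisphere)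
    (zA : 0 < A.2.2) (zD : 0 < D.2.2) (hAB : A ≠ B) (hAC : A ≠ C) (hAD : A ≠ D)
    (hBD : B ≠ D) (hCD : C ≠ D)
    {μ ν : ℝ} (hμ : (dist3 A D)⁻¹ • A + (dist3 B D)⁻¹ • B + (dist3 C D)⁻¹ • C = μ • D)
    (hν : (dist3 D A)⁻¹ • D + (dist3 B A)⁻¹ • B + (dist3 C A)⁻¹ • C = ν • A) :
    sumDist A B C D ≤ 4 + 4 * Real.sqrt 2 := by
  have uA := dot3_self_of_mem hA
  have uB := dot3_self_of_mem hB
  have uC := dot3_self_of_mem hC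
  have uD := dot3_self_of_mem hD
  have zB := hB.2
  have zC := hC.2
  have hpos : ∀ {P Q : ℝ × ℝ × ℝ}, P ≠ Q → 0 < (dist3 P Q)⁻¹ := fun h => inv_pos.2 (dist3_pos h)
  have a₀ := hpos hAD
  have b₀ := hpos hBD
  have c₀ := hpos hCD
  have b₁ := hpos hAB.symm
  have c₁ := hpos hAC.symm
  rw [dist3_comm D A] at hν
  set a := (dist3 A D)⁻¹
  set b := (dist3 B D)⁻¹
  set c := (dist3 C D)⁻¹
  set b' := (dist3 B A)⁻¹
  set c' := (dist3 C A)⁻¹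
  have μ₀ : 0 < μ := by
    have h : a * A.2.2 + b * B.2.2 + c * C.2.2 = μ * D.2.2 := by
      simpa using congrArg (fun P : ℝ × ℝ × ℝ => P.2.2) hμ
    have : 0 < μ * D.2.2 := by rw [← h]; positivity
    exact pos_of_mul_pos_left this zD.le
  have ν₀ : 0 < ν := by
    have h : a * D.2.2 + b' * B.2.2 + c' * C.2.2 = ν * A.2.2 := by
      simpa using congrArg (fun P : ℝ × ℝ × ℝ => P.2.2) hν
    have : 0 < ν * A.2.2 := by rw [← h]; positivity
    exact pos_of_mul_pos_left this zA.le
  have eC : (c * b' - c' * b) • C = (μ * b' + a * b) • D - (a * b' + ν * b) • A := by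
    have h : (c * b' - c' * b) • C = b' • (a • A + b • B + c • C) - b • (a • D + b' • B + c' • C)
        + (a * b) • D - (a * b') • A := by module
    rw [h, hμ, hν]
    module
  have eB : (b * c' - b' * c) • B = (μ * c' + a * c) • D - (a * c' + ν * c) • A := by
    have h : (b * c' - b' * c) • B = c' • (a • A + b • B + c • C) - c • (a • D + b' • B + c' • C)
        + (a * c) • D - (a * c') • A := by module
    rw [h, hμ, hν]
    module
  have parallel : ∀ p q : ℝ, 0 < p → 0 < q → q • D - p • A ≠ 0 := by
    intro p q hp hq h
    have h1 : q * D.1 = p * A.1 := by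
      have := congrArg (fun P : ℝ × ℝ × ℝ => P.1) h
      simp at this; linarith
    have h2 : q * D.2.1 = p * A.2.1 := by
      have := congrArg (fun P : ℝ × ℝ × ℝ => P.2.1) h
      simp at this; linarith
    have h3 : q * D.2.2 = p * A.2.2 := by
      have := congrArg (fun P : ℝ × ℝ × ℝ => P.2.2) h
      simp at this; linarith
    have hsq : q ^ 2 = p ^ 2 := by
      unfold dot3 at uA uD
      linear_combination (-q ^ 2) * uD + p ^ 2 * uA + (q * D.1 + p * A.1) * h1 +
        (q * D.2.1 + p * A.2.1) * h2 + (q * D.2.2 + p * A.2.2) * h3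
    have hqp : q = p := (pow_left_inj₀ hq.le hp.le two_ne_zero).1 hsq
    subst hqp
    apply hAD
    ext
    · exact (mul_left_cancel₀ hq.ne' h1).symm
    · exact (mul_left_cancel₀ hq.ne' h2).symm
    · exact (mul_left_cancel₀ hq.ne' h3).symm
  have hk : c * b' - c' * b ≠ 0 := by
    intro h
    rw [h, zero_smul] at eC
    exact parallel _ _ (by positivity) (by positivity) eC.symm
  have hk' : b * c' - b' * c ≠ 0 := fun h => hk (by linarith)
  refine sumDist_le_of_span hAD uA uB uC uD ?_ ?_ ?_
  · intro h
    have h' : A.2.2 + D.2.2 = 0 := by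
      unfold dot3 at uA uD h
      nlinarith [sq_nonneg (A.1 + D.1), sq_nonneg (A.2.1 + D.2.1), sq_nonneg (A.2.2 + D.2.2)]
    linarith
  · refine ⟨-((b * c' - b' * c)⁻¹ * (a * c' + ν * c)), (b * c' - b' * c)⁻¹ * (μ * c' + a * c), ?_⟩
    rw [← one_smul ℝ B, ← inv_mul_cancel₀ hk', mul_smul, eB]
    module
  · refine ⟨-((c * b' - c' * b)⁻¹ * (a * b' + ν * b)), (c * b' - c' * b)⁻¹ * (μ * b' + a * b), ?_⟩
    rw [← one_smul ℝ C, ← inv_mul_cancel₀ hk, mul_smul, eC]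
    module

lemma three_chords_add_le {u v w p q r : ℝ} (hu : 1 / 2 ≤ u) (hv : 1 / 2 ≤ v) (hw : 1 / 2 ≤ w)
    (hp : u * v * p ^ 2 = (u + v) ^ 2 - w ^ 2) (hq : v * w * q ^ 2 = (v + w) ^ 2 - u ^ 2)
    (hr : u * w * r ^ 2 = (u + w) ^ 2 - v ^ 2)
    (hS : u * v + v * w + u * w = 2 * (u + v + w) * (u * v * w)) :
    p + q + r + 2 * (u + v + w) ≤ 193 / 20 := by
  set σ := u + v + w with hσ
  set e := u * v * w with he
  have he₀ : 0 < e := by positivity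
  have hσ₀ : 3 / 2 ≤ σ := by linarith
  have hQ : e * (8 * σ ^ 2 - (p ^ 2 + q ^ 2 + r ^ 2)) = σ ^ 3 := by
    linear_combination (-w) * hp - u * hq - v * hr - 4 * σ * hS
  have he₁ : e * (σ - 1) ≤ (2 * σ - 1) / 8 := by
    have := mul_nonneg (mul_nonneg (sub_nonneg.2 hu) (sub_nonneg.2 hv)) (sub_nonneg.2 hw)
    linarith
  have he₂ : 2 * σ * e ≤ σ ^ 2 / 3 := by
    have h : σ ^ 2 / 3 - (u * v + v * w + u * w)
        = ((u - v) ^ 2 + (v - w) ^ 2 + (u - w) ^ 2) / 6 := by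
      rw [hσ]
      ring
    rw [← hS, ← sub_nonneg, h]
    positivity
  have he₃ : 3 * σ * e ≤ (2 * σ * e) ^ 2 := by
    have h : (2 * σ * e) ^ 2 - 3 * σ * e = ((u * v - v * w) ^ 2 + (v * w - u * w) ^ 2
        + (u * v - u * w) ^ 2) / 2 := by
      rw [← hS, hσ, he]
      ring
    rw [← sub_nonneg, h]
    positivity
  have he₄ : 3 / 2 ≤ 2 * σ * e := by
    refine le_of_mul_le_mul_right ?_ (show 0 < 2 * σ * e by positivity)
    linarith
  have hσ₁ : 53 / 25 ≤ σ := by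
    refine (pow_le_pow_iff_left₀ (by norm_num) (by linarith) two_ne_zero).1 ?_
    linarith
  have hR₀ : 0 ≤ 8 * σ ^ 2 - (p ^ 2 + q ^ 2 + r ^ 2) := by
    have : 0 < σ ^ 3 := by positivity
    rw [← hQ] at this
    exact (pos_of_mul_pos_right this he₀.le).le
  have hR : σ ^ 3 * (σ - 1) ≤ (2 * σ - 1) / 8 * (8 * σ ^ 2 - (p ^ 2 + q ^ 2 + r ^ 2)) := by
    have := mul_le_mul_of_nonneg_right he₁ hR₀
    calc σ ^ 3 * (σ - 1) = e * (σ - 1) * (8 * σ ^ 2 - (p ^ 2 + q ^ 2 + r ^ 2)) := by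
          rw [← hQ]; ring
      _ ≤ _ := this
  have hsum : p + q + r ≤ (p ^ 2 + q ^ 2 + r ^ 2 + 147 / 16) / (7 / 2) := by
    linarith [sq_nonneg (p - 7 / 4), sq_nonneg (q - 7 / 4), sq_nonneg (r - 7 / 4)]
  by_contra! hlt
  have hQ' : 24.5875 - 7 * σ < p ^ 2 + q ^ 2 + r ^ 2 := by norm_num; linarith
  have hfin : 8 * σ ^ 4 - 24 * σ ^ 3 - 6 * σ ^ 2 + 56.175 * σ - 24.5875 < 0 := by
    have := mul_lt_mul_of_pos_left hQ' (show 0 < 2 * σ - 1 by linarith)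
    linarith
  obtain ⟨t, ht⟩ : ∃ t, t = σ - 53 / 25 := ⟨_, rfl⟩
  have ht₀ : 0 ≤ t := by linarith
  rw [show σ = t + 53 / 25 by linarith] at hfin
  linarith [pow_nonneg ht₀ 2, pow_nonneg ht₀ 3, pow_nonneg ht₀ 4]

lemma sumDist_le_of_one_off_equator {A B C D : ℝ × ℝ × ℝ} (hA : dot3 A A = 1) (hB : dot3 B B = 1)
    (hC : dot3 C C = 1) (hD : dot3 D D = 1) (zA : A.2.2 = 0) (zB : B.2.2 = 0) (zC : C.2.2 = 0)
    (zD : 0 < D.2.2) (hAD : A ≠ D) (hBD : B ≠ D) (hCD : C ≠ D) {μ : ℝ}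
    (hμ : (dist3 A D)⁻¹ • A + (dist3 B D)⁻¹ • B + (dist3 C D)⁻¹ • C = μ • D) :
    sumDist A B C D ≤ 4 + 4 * Real.sqrt 2 := by
  have a₀ := dist3_pos hAD
  have b₀ := dist3_pos hBD
  have c₀ := dist3_pos hCD
  have half : ∀ {x : ℝ}, 0 < x → x ≤ 2 → 1 / 2 ≤ x⁻¹ := fun h h' => by
    rw [one_div]; exact inv_anti₀ h h'
  have hu := half a₀ (dist3_le_two hA hD)
  have hv := half b₀ (dist3_le_two hB hD)
  have hw := half c₀ (dist3_le_two hC hD)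
  have sa := dist3_sq hA hD
  have sb := dist3_sq hB hD
  have sc := dist3_sq hC hD
  have ab := dist3_sq hA hB
  have ac := dist3_sq hA hC
  have bc := dist3_sq hB hC
  have hu' := mul_inv_cancel₀ a₀.ne'
  have hv' := mul_inv_cancel₀ b₀.ne'
  have hw' := mul_inv_cancel₀ c₀.ne'
  set a := dist3 A D
  set b := dist3 B D
  set c := dist3 C D
  set u := a⁻¹
  set v := b⁻¹
  set w := c⁻¹
  have e₁ : u * A.1 + v * B.1 + w * C.1 = μ * D.1 := by
    simpa using congrArg (fun P : ℝ × ℝ × ℝ => P.1) hμ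
  have e₂ : u * A.2.1 + v * B.2.1 + w * C.2.1 = μ * D.2.1 := by
    simpa using congrArg (fun P : ℝ × ℝ × ℝ => P.2.1) hμ
  have e₃ : u * A.2.2 + v * B.2.2 + w * C.2.2 = μ * D.2.2 := by
    simpa using congrArg (fun P : ℝ × ℝ × ℝ => P.2.2) hμ
  have μ₀ : μ = 0 := by
    rw [zA, zB, zC] at e₃
    have : μ * D.2.2 = 0 := by linarith
    exact (mul_eq_zero.1 this).resolve_right zD.ne'
  rw [μ₀, zero_mul] at e₁ e₂
  have balance : a + b + c = 2 * (u + v + w) := by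
    have hd : u * dot3 A D + v * dot3 B D + w * dot3 C D = 0 := by
      unfold dot3
      rw [zA, zB, zC]
      linear_combination D.1 * e₁ + D.2.1 * e₂
    linear_combination (-1) * a * hu' - b * hv' - c * hw' + u * sa + v * sb + w * sc - 2 * hd
  have hS : u * v + v * w + u * w = 2 * (u + v + w) * (u * v * w) := by
    rw [← balance]
    linear_combination (-(v * w)) * hu' - (u * w) * hv' - (u * v) * hw'
  have nA : A.1 ^ 2 + A.2.1 ^ 2 = 1 := by rw [← hA, dot3, zA]; ring
  have nB : B.1 ^ 2 + B.2.1 ^ 2 = 1 := by rw [← hB, dot3, zB]; ring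
  have nC : C.1 ^ 2 + C.2.1 ^ 2 = 1 := by rw [← hC, dot3, zC]; ring
  have key := three_chords_add_le hu hv hw (p := dist3 A B) (q := dist3 B C) (r := dist3 A C)
    (by
      rw [ab, dot3, zA, zB]
      linear_combination u ^ 2 * nA + v ^ 2 * nB - w ^ 2 * nC -
        (u * A.1 + v * B.1 - w * C.1) * e₁ - (u * A.2.1 + v * B.2.1 - w * C.2.1) * e₂)
    (by
      rw [bc, dot3, zB, zC]
      linear_combination v ^ 2 * nB + w ^ 2 * nC - u ^ 2 * nA -
        (v * B.1 + w * C.1 - u * A.1) * e₁ - (v * B.2.1 + w * C.2.1 - u * A.2.1) * e₂)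
    (by
      rw [ac, dot3, zA, zC]
      linear_combination u ^ 2 * nA + w ^ 2 * nC - v ^ 2 * nB -
        (u * A.1 + w * C.1 - v * B.1) * e₁ - (u * A.2.1 + w * C.2.1 - v * B.2.1) * e₂)
    hS
  have hle : 1414 / 1000 ≤ Real.sqrt 2 := Real.le_sqrt_of_sq_le (by norm_num)
  change dist3 A B + dist3 A C + a + dist3 B C + b + c ≤ _
  linarith

lemma sumDist_le_of_equator {A B C D : ℝ × ℝ × ℝ} (hA : dot3 A A = 1) (hB : dot3 B B = 1)
    (hC : dot3 C C = 1) (hD : dot3 D D = 1) (zA : A.2.2 = 0) (zB : B.2.2 = 0) (zC : C.2.2 = 0)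
    (zD : D.2.2 = 0) : sumDist A B C D ≤ 4 + 4 * Real.sqrt 2 := by
  have h : ∀ P : ℝ × ℝ × ℝ, P.2.2 = 0 →
      ∃ x y : ℝ, P = x • ((1 : ℝ), (0 : ℝ), (0 : ℝ)) + y • ((0 : ℝ), (1 : ℝ), (0 : ℝ)) := by
    intro P hP
    refine ⟨P.1, P.2.1, ?_⟩
    ext <;> simp [hP]
  exact sumDist_le_of_great_circle (by simp [dot3]) (by simp [dot3]) (by simp [dot3])
    hA hB hC hD (h A zA) (h B zB) (h C zC) (h D zD)

/-! ### Conclusion -/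

lemma isCompact_upperHemisphere : IsCompact upperHemisphere := by
  refine Metric.isCompact_of_isClosed_isBounded ?_ ?_
  · have h₁ : Continuous fun p : ℝ × ℝ × ℝ => p.1 ^ 2 + p.2.1 ^ 2 + p.2.2 ^ 2 := by fun_prop
    have h₂ : Continuous fun p : ℝ × ℝ × ℝ => p.2.2 := by fun_prop
    exact (isClosed_eq h₁ continuous_const).inter (isClosed_le continuous_const h₂)
  · refine (Metric.isBounded_closedBall (x := (0 : ℝ × ℝ × ℝ)) (r := 1)).subset ?_
    rintro ⟨x, y, z⟩ ⟨h, -⟩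
    simp only at h
    rw [mem_closedBall_zero_iff, Prod.norm_def, Prod.norm_def]
    simp only [Real.norm_eq_abs, sup_le_iff]
    refine ⟨?_, ?_, ?_⟩ <;> rw [← sq_le_one_iff_abs_le_one] <;>
      nlinarith [sq_nonneg x, sq_nonneg y, sq_nonneg z]

/-- A quadruple of points of the hemisphere with the largest possible sum of distances. -/
def IsMaxQuadruple (A B C D : ℝ × ℝ × ℝ) : Prop :=
  (A ∈ upperHemisphere ∧ B ∈ upperHemisphere ∧ C ∈ upperHemisphere ∧ D ∈ upperHemisphere) ∧
    ∀ A' ∈ upperHemisphere, ∀ B' ∈ upperHemisphere, ∀ C' ∈ upperHemisphere,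
      ∀ D' ∈ upperHemisphere, sumDist A' B' C' D' ≤ sumDist A B C D

lemma exists_isMaxQuadruple : ∃ A B C D, IsMaxQuadruple A B C D := by
  have hK := isCompact_upperHemisphere.prod (isCompact_upperHemisphere.prod
    (isCompact_upperHemisphere.prod isCompact_upperHemisphere))
  have h₀ : ((1 : ℝ), (0 : ℝ), (0 : ℝ)) ∈ upperHemisphere := by simp [upperHemisphere]
  have hcont : Continuous fun x : (ℝ × ℝ × ℝ) × (ℝ × ℝ × ℝ) × (ℝ × ℝ × ℝ) × (ℝ × ℝ × ℝ) =>
      sumDist x.1 x.2.1 x.2.2.1 x.2.2.2 := by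
    unfold sumDist dist3
    fun_prop
  obtain ⟨⟨A, B, C, D⟩, ⟨hA, hB, hC, hD⟩, hmax⟩ :=
    hK.exists_isMaxOn ⟨(_, _, _, _), h₀, h₀, h₀, h₀⟩ hcont.continuousOn
  exact ⟨A, B, C, D, ⟨hA, hB, hC, hD⟩, fun A' hA' B' hB' C' hC' D' hD' =>
    hmax (a := (A', B', C', D')) ⟨hA', hB', hC', hD'⟩⟩

namespace IsMaxQuadruple

variable {A B C D : ℝ × ℝ × ℝ}

lemma swap₁₂ (h : IsMaxQuadruple A B C D) : IsMaxQuadruple B A C D := by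
  obtain ⟨⟨hA, hB, hC, hD⟩, hm⟩ := h
  refine ⟨⟨hB, hA, hC, hD⟩, ?_⟩
  rwa [(sumDist_perm A B C D).1]

lemma swap₂₃ (h : IsMaxQuadruple A B C D) : IsMaxQuadruple A C B D := by
  obtain ⟨⟨hA, hB, hC, hD⟩, hm⟩ := h
  refine ⟨⟨hA, hC, hB, hD⟩, ?_⟩
  rwa [(sumDist_perm A B C D).2.1]

lemma swap₃₄ (h : IsMaxQuadruple A B C D) : IsMaxQuadruple A B D C := by
  obtain ⟨⟨hA, hB, hC, hD⟩, hm⟩ := h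
  refine ⟨⟨hA, hB, hD, hC⟩, ?_⟩
  rwa [(sumDist_perm A B C D).2.2]

lemma sumDist_eq {A' B' C' D' : ℝ × ℝ × ℝ} (h : IsMaxQuadruple A B C D)
    (h' : IsMaxQuadruple A' B' C' D') : sumDist A B C D = sumDist A' B' C' D' :=
  le_antisymm (h'.2 _ h.1.1 _ h.1.2.1 _ h.1.2.2.1 _ h.1.2.2.2)
    (h.2 _ h'.1.1 _ h'.1.2.1 _ h'.1.2.2.1 _ h'.1.2.2.2)

lemma le_of_eq (h : IsMaxQuadruple A B C D) (hAD : A = D) :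
    sumDist A B C D ≤ 4 + 4 * Real.sqrt 2 := by
  subst hAD
  exact sumDist_le_of_eq (dot3_self_of_mem h.1.1) (dot3_self_of_mem h.1.2.1)
    (dot3_self_of_mem h.1.2.2.1)

lemma critical (h : IsMaxQuadruple A B C D) (hz : 0 < D.2.2)
    (hAD : A ≠ D) (hBD : B ≠ D) (hCD : C ≠ D) :
    ∃ μ : ℝ, (dist3 A D)⁻¹ • A + (dist3 B D)⁻¹ • B + (dist3 C D)⁻¹ • C = μ • D := by
  obtain ⟨⟨hA, hB, hC, hD⟩, hm⟩ := h
  refine critical_of_max (dot3_self_of_mem hA) (dot3_self_of_mem hB) (dot3_self_of_mem hC)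
    (dot3_self_of_mem hD) hz hAD hBD hCD fun P hP => ?_
  have := hm A hA B hB C hC P hP
  unfold sumDist at this
  linarith

lemma le_of_pos_of_pos (h : IsMaxQuadruple A B C D)
    (hd : A ≠ B ∧ A ≠ C ∧ A ≠ D ∧ B ≠ D ∧ C ≠ D) (zA : 0 < A.2.2) (zD : 0 < D.2.2) :
    sumDist A B C D ≤ 4 + 4 * Real.sqrt 2 := by
  obtain ⟨hAB, hAC, hAD, hBD, hCD⟩ := hd
  obtain ⟨μ, hμ⟩ := h.critical zD hAD hBD hCD
  have h' : IsMaxQuadruple D B C A := h.swap₁₂.swap₂₃.swap₃₄.swap₂₃.swap₁₂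
  obtain ⟨ν, hν⟩ := h'.critical zA hAD.symm hAB.symm hAC.symm
  exact sumDist_le_of_two_off_equator h.1.1 h.1.2.1 h.1.2.2.1 h.1.2.2.2 zA zD hAB hAC hAD hBD hCD
    hμ hν

lemma le_of_pos (h : IsMaxQuadruple A B C D)
    (hd : A ≠ B ∧ A ≠ C ∧ A ≠ D ∧ B ≠ C ∧ B ≠ D ∧ C ≠ D) (zD : 0 < D.2.2) :
    sumDist A B C D ≤ 4 + 4 * Real.sqrt 2 := by
  obtain ⟨hAB, hAC, hAD, hBC, hBD, hCD⟩ := hd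
  rcases h.1.1.2.lt_or_eq with zA | zA
  · exact h.le_of_pos_of_pos ⟨hAB, hAC, hAD, hBD, hCD⟩ zA zD
  rcases h.1.2.1.2.lt_or_eq with zB | zB
  · rw [h.sumDist_eq h.swap₁₂]
    exact h.swap₁₂.le_of_pos_of_pos ⟨hAB.symm, hBC, hBD, hAD, hCD⟩ zB zD
  rcases h.1.2.2.1.2.lt_or_eq with zC | zC
  · rw [h.sumDist_eq h.swap₂₃.swap₁₂]
    exact h.swap₂₃.swap₁₂.le_of_pos_of_pos ⟨hAC.symm, hBC.symm, hCD, hAD, hBD⟩ zC zD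
  obtain ⟨μ, hμ⟩ := h.critical zD hAD hBD hCD
  obtain ⟨⟨hA, hB, hC, hD⟩, -⟩ := h
  exact sumDist_le_of_one_off_equator (dot3_self_of_mem hA) (dot3_self_of_mem hB)
    (dot3_self_of_mem hC) (dot3_self_of_mem hD) zA.symm zB.symm zC.symm zD hAD hBD hCD hμ

lemma sumDist_le (h : IsMaxQuadruple A B C D) : sumDist A B C D ≤ 4 + 4 * Real.sqrt 2 := by
  by_cases hAD : A = D
  · exact h.le_of_eq hAD
  by_cases hBD : B = D
  · rw [h.sumDist_eq h.swap₁₂]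
    exact h.swap₁₂.le_of_eq hBD
  by_cases hCD : C = D
  · rw [h.sumDist_eq h.swap₂₃.swap₁₂]
    exact h.swap₂₃.swap₁₂.le_of_eq hCD
  by_cases hAC : A = C
  · rw [h.sumDist_eq h.swap₃₄]
    exact h.swap₃₄.le_of_eq hAC
  by_cases hBC : B = C
  · rw [h.sumDist_eq h.swap₃₄.swap₁₂]
    exact h.swap₃₄.swap₁₂.le_of_eq hBC
  by_cases hAB : A = B
  · rw [h.sumDist_eq h.swap₂₃.swap₃₄]
    exact h.swap₂₃.swap₃₄.le_of_eq hAB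
  rcases h.1.2.2.2.2.lt_or_eq with zD | zD
  · exact h.le_of_pos ⟨hAB, hAC, hAD, hBC, hBD, hCD⟩ zD
  rcases h.1.2.2.1.2.lt_or_eq with zC | zC
  · rw [h.sumDist_eq h.swap₃₄]
    exact h.swap₃₄.le_of_pos ⟨hAB, hAD, hAC, hBD, hBC, Ne.symm hCD⟩ zC
  rcases h.1.2.1.2.lt_or_eq with zB | zB
  · rw [h.sumDist_eq h.swap₂₃.swap₃₄]
    exact h.swap₂₃.swap₃₄.le_of_pos ⟨hAC, hAD, hAB, hCD, Ne.symm hBC, Ne.symm hBD⟩ zB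
  rcases h.1.1.2.lt_or_eq with zA | zA
  · rw [h.sumDist_eq h.swap₁₂.swap₂₃.swap₃₄]
    exact h.swap₁₂.swap₂₃.swap₃₄.le_of_pos
      ⟨hBC, hBD, Ne.symm hAB, hCD, Ne.symm hAC, Ne.symm hAD⟩ zA
  obtain ⟨⟨hA, hB, hC, hD⟩, -⟩ := h
  exact sumDist_le_of_equator (dot3_self_of_mem hA) (dot3_self_of_mem hB)
    (dot3_self_of_mem hC) (dot3_self_of_mem hD) zA.symm zB.symm zC.symm zD.symm

end IsMaxQuadruple

lemma sumDist_square_config :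
    sumDist ((0 : ℝ), (-1 : ℝ), (0 : ℝ)) ((1 : ℝ), (0 : ℝ), (0 : ℝ))
        ((-1 : ℝ), (0 : ℝ), (0 : ℝ)) ((0 : ℝ), (1 : ℝ), (0 : ℝ))
      = 4 + 4 * Real.sqrt 2 := by
  have h : Real.sqrt 4 = 2 := by
    rw [show (4 : ℝ) = 2 ^ 2 by norm_num, Real.sqrt_sq two_pos.le]
  norm_num [sumDist, dist3, h]
  ring

theorem square_config_attains_max :
    (((0 : ℝ), (-1 : ℝ), (0 : ℝ)) ∈ upperHemisphere ∧
     ((1 : ℝ), (0 : ℝ), (0 : ℝ)) ∈ upperHemisphere ∧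
     ((-1 : ℝ), (0 : ℝ), (0 : ℝ)) ∈ upperHemisphere ∧
     ((0 : ℝ), (1 : ℝ), (0 : ℝ)) ∈ upperHemisphere) ∧
    sumDist ((0 : ℝ), (-1 : ℝ), (0 : ℝ)) ((1 : ℝ), (0 : ℝ), (0 : ℝ))
        ((-1 : ℝ), (0 : ℝ), (0 : ℝ)) ((0 : ℝ), (1 : ℝ), (0 : ℝ))
      = 4 + 4 * Real.sqrt 2 ∧
    IsGreatest
      {s : ℝ | ∃ A ∈ upperHemisphere, ∃ B ∈ upperHemisphere,
        ∃ C ∈ upperHemisphere, ∃ D ∈ upperHemisphere, s = sumDist A B C D}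
      (4 + 4 * Real.sqrt 2) := by
  have hA : ((0 : ℝ), (-1 : ℝ), (0 : ℝ)) ∈ upperHemisphere := by simp [upperHemisphere]
  have hB : ((1 : ℝ), (0 : ℝ), (0 : ℝ)) ∈ upperHemisphere := by simp [upperHemisphere]
  have hC : ((-1 : ℝ), (0 : ℝ), (0 : ℝ)) ∈ upperHemisphere := by simp [upperHemisphere]
  have hD : ((0 : ℝ), (1 : ℝ), (0 : ℝ)) ∈ upperHemisphere := by simp [upperHemisphere]
  refine ⟨⟨hA, hB, hC, hD⟩, sumDist_square_config,
    ⟨_, hA, _, hB, _, hC, _, hD, sumDist_square_config.symm⟩, ?_⟩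
  rintro s ⟨A, hA, B, hB, C, hC, D, hD, rfl⟩
  obtain ⟨A', B', C', D', h⟩ := exists_isMaxQuadruple
  exact (h.2 A hA B hB C hC D hD).trans h.sumDist_le
end

section
/- If four points A, B, C, D on the closed unit upper hemisphere S²_{≥0} maximize the sum of the six pairwise Euclidean distances among all quadruples of points of S²_{≥0}, then the center O = (0,0,0) of the sphere is contained in the convex hull of {A, B, C, D} (i.e., O lies in the interior of the tetrahedron ABCD or on one of its faces, or inside the planar quadrilateral if the four points are coplanar). -/
open Filter Topology

section Retract

variable {E : Type*} [NormedAddCommGroup E] [InnerProductSpace ℝ E]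

/-- Translate `P` by `-t • w` and project the result radially to the unit sphere. -/
noncomputable def retract (w : E) (t : ℝ) (P : E) : E := ‖P - t • w‖⁻¹ • (P - t • w)

lemma norm_sub_sq_of_norm_eq_one {x y : E} (hx : ‖x‖ = 1) (hy : ‖y‖ = 1) :
    ‖x - y‖ ^ 2 = 2 - 2 * inner ℝ x y := by
  rw [norm_sub_sq_real, hx, hy]; ring

lemma eventually_mul_lt (k : ℝ) {m : ℝ} (hm : 0 < m) : ∀ᶠ t : ℝ in 𝓝[>] 0, t * k < m := by
  have h : Tendsto (fun t : ℝ => t * k) (𝓝[>] 0) (𝓝 (0 * k)) :=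
    ((continuous_id.mul continuous_const).tendsto 0).mono_left nhdsWithin_le_nhds
  rw [zero_mul] at h
  exact h.eventually_lt_const hm

/-- For small `t > 0`, retracting a point of the open hemisphere around `w` gives a point of that
hemisphere. -/
lemma eventually_retract_mem {w P : E} (h : 0 < inner ℝ w P) :
    ∀ᶠ t : ℝ in 𝓝[>] 0, ‖retract w t P‖ = 1 ∧ 0 ≤ inner ℝ w (retract w t P) := by
  filter_upwards [eventually_mul_lt (‖w‖ ^ 2) h] with t ht
  have hX : 0 < inner ℝ w (P - t • w) := by
    rw [inner_sub_right, real_inner_smul_right, real_inner_self_eq_norm_sq]; linarith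
  have h0 : P - t • w ≠ 0 := fun h0 => by simp [h0] at hX
  refine ⟨?_, ?_⟩
  · rw [retract, norm_smul, norm_inv, norm_norm, inv_mul_cancel₀ (norm_ne_zero_iff.2 h0)]
  · rw [retract, real_inner_smul_right]; positivity

/-- Retracting two distinct points of the open hemisphere around `w` increases their distance. -/
lemma eventually_norm_sub_lt_retract {w P Q : E} (hP : ‖P‖ = 1) (hQ : ‖Q‖ = 1)
    (ha : 0 < inner ℝ w P) (hb : 0 < inner ℝ w Q) (hne : P ≠ Q) :
    ∀ᶠ t : ℝ in 𝓝[>] 0, ‖P - Q‖ < ‖retract w t P - retract w t Q‖ := by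
  have hc : inner ℝ P Q < 1 := by
    have h := norm_sub_sq_of_norm_eq_one hP hQ
    have : 0 < ‖P - Q‖ := norm_pos_iff.2 (sub_ne_zero.2 hne)
    nlinarith
  filter_upwards [eventually_retract_mem ha, eventually_retract_mem hb,
    eventually_mul_lt (inner ℝ w P) one_pos, eventually_mul_lt (inner ℝ w Q) one_pos,
    eventually_mul_lt (‖w‖ ^ 2) ha, eventually_mul_lt (‖w‖ ^ 2) hb,
    eventually_mul_lt (‖w‖ ^ 2 - inner ℝ P Q * (inner ℝ w P * inner ℝ w Q))
      (mul_pos (sub_pos.2 hc) (add_pos ha hb)), self_mem_nhdsWithin]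
    with t hRP hRQ hta htb htP htQ htc ht
  replace ht : 0 < t := ht
  refine lt_of_pow_lt_pow_left₀ 2 (norm_nonneg _) ?_
  rw [norm_sub_sq_of_norm_eq_one hP hQ, norm_sub_sq_of_norm_eq_one hRP.1 hRQ.1]
  have norm_bounds : ∀ R : E, ‖R‖ = 1 → t * ‖w‖ ^ 2 < inner ℝ w R →
      1 - t * inner ℝ w R ≤ ‖R - t • w‖ ∧ ‖R - t • w‖ ≤ 1 := by
    intro R hR htR
    constructor
    · have h := real_inner_le_norm (R - t • w) R
      rw [inner_sub_left, real_inner_smul_left, real_inner_self_eq_norm_sq, hR] at h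
      linarith
    · have h : ‖R - t • w‖ ^ 2 = 1 - 2 * (t * inner ℝ w R) + t * (t * ‖w‖ ^ 2) := by
        rw [norm_sub_sq_real, hR, real_inner_smul_right, norm_smul, real_inner_comm,
          Real.norm_of_nonneg ht.le]
        ring
      have h2 : ‖R - t • w‖ ^ 2 ≤ 1 ^ 2 := by nlinarith [mul_pos ht ht, sq_nonneg ‖w‖]
      exact (sq_le_sq₀ (norm_nonneg _) zero_le_one).1 h2
  obtain ⟨hp, hp1⟩ := norm_bounds P hP htP
  obtain ⟨hq, hq1⟩ := norm_bounds Q hQ htQ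
  have hXY : inner ℝ (P - t • w) (Q - t • w) =
      inner ℝ P Q - t * (inner ℝ w P + inner ℝ w Q) + t * (t * ‖w‖ ^ 2) := by
    rw [inner_sub_left, inner_sub_right, inner_sub_right, real_inner_smul_left,
      real_inner_smul_left, real_inner_smul_right, real_inner_smul_right,
      real_inner_self_eq_norm_sq, real_inner_comm w P]
    ring
  have hp0 : 0 < ‖P - t • w‖ := by linarith
  have hq0 : 0 < ‖Q - t • w‖ := by linarith
  have key : inner ℝ (P - t • w) (Q - t • w) <
      inner ℝ P Q * (‖P - t • w‖ * ‖Q - t • w‖) := by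
    rw [hXY]
    rcases le_or_gt 0 (inner ℝ P Q) with h0 | h0
    · have h1 : (1 - t * inner ℝ w P) * (1 - t * inner ℝ w Q) ≤ ‖P - t • w‖ * ‖Q - t • w‖ :=
        mul_le_mul hp hq (by linarith) hp0.le
      have h2 := mul_le_mul_of_nonneg_left h1 h0
      have h3 := mul_lt_mul_of_pos_left htc ht
      linarith
    · have h1 : ‖P - t • w‖ * ‖Q - t • w‖ ≤ 1 := mul_le_one₀ hp1 hq0.le hq1
      have h2 := mul_le_mul_of_nonpos_left h1 h0.le
      have h3 := mul_lt_mul_of_pos_left htP ht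
      have h4 := mul_pos ht hb
      linarith
  have : inner ℝ (retract w t P) (retract w t Q) < inner ℝ P Q := by
    rw [retract, retract, real_inner_smul_left, real_inner_smul_right, ← mul_assoc, ← mul_inv,
      inv_mul_lt_iff₀ (mul_pos hp0 hq0), mul_comm]
    exact key
  linarith

lemma eventually_eq_or_norm_sub_lt_retract {w P Q : E} (hP : ‖P‖ = 1) (hQ : ‖Q‖ = 1)
    (ha : 0 < inner ℝ w P) (hb : 0 < inner ℝ w Q) :
    ∀ᶠ t : ℝ in 𝓝[>] 0, P = Q ∨ ‖P - Q‖ < ‖retract w t P - retract w t Q‖ := by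
  by_cases h : P = Q
  · simp [h]
  · exact (eventually_norm_sub_lt_retract hP hQ ha hb h).mono fun _ => Or.inr

/-- Equal-norm vectors are exchanged by a linear isometry. -/
lemma exists_linearIsometryEquiv_apply_eq {v w : E} (h : ‖v‖ = ‖w‖) :
    ∃ U : E ≃ₗᵢ[ℝ] E, U v = w :=
  ⟨_, Submodule.reflection_sub h⟩

end Retract

/-- The point of Euclidean space with the given coordinates. -/
noncomputable def toEuclidean3 (P : ℝ × ℝ × ℝ) : EuclideanSpace ℝ (Fin 3) := !₂[P.1, P.2.1, P.2.2]

/-- The north pole. -/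
noncomputable def northPole : EuclideanSpace ℝ (Fin 3) := !₂[0, 0, 1]

lemma toEuclidean3_surjective : Function.Surjective toEuclidean3 := fun x =>
  ⟨(x 0, x 1, x 2), by ext i; fin_cases i <;> rfl⟩

lemma toEuclidean3_injective : Function.Injective toEuclidean3 := fun P Q h => by
  have h0 := congrArg (fun x : EuclideanSpace ℝ (Fin 3) => x 0) h
  have h1 := congrArg (fun x : EuclideanSpace ℝ (Fin 3) => x 1) h
  have h2 := congrArg (fun x : EuclideanSpace ℝ (Fin 3) => x 2) h
  exact Prod.ext h0 (Prod.ext h1 h2)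

lemma dist3_eq_norm_sub (P Q : ℝ × ℝ × ℝ) :
    dist3 P Q = ‖toEuclidean3 P - toEuclidean3 Q‖ := by
  simp [dist3, toEuclidean3, EuclideanSpace.norm_eq, Fin.sum_univ_three]

lemma mem_upperHemisphere_iff (P : ℝ × ℝ × ℝ) :
    P ∈ upperHemisphere ↔
      ‖toEuclidean3 P‖ = 1 ∧ 0 ≤ inner ℝ northPole (toEuclidean3 P) := by
  simp [upperHemisphere, toEuclidean3, northPole, EuclideanSpace.norm_eq, Fin.sum_univ_three,
    PiLp.inner_apply]

lemma exists_inner_pos_of_notMem_convexHull {s : Set (ℝ × ℝ × ℝ)} (hs : s.Finite)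
    (h : (0 : ℝ × ℝ × ℝ) ∉ convexHull ℝ s) :
    ∃ w : EuclideanSpace ℝ (Fin 3), ∀ P ∈ s, 0 < inner ℝ w (toEuclidean3 P) := by
  obtain ⟨f, u, hu, hf⟩ := geometric_hahn_banach_point_closed (convex_convexHull ℝ s)
    (hs.isCompact_convexHull ℝ).isClosed h
  refine ⟨!₂[f (1, 0, 0), f (0, 1, 0), f (0, 0, 1)], fun P hP => ?_⟩
  have hP' : f P = P.1 * f (1, 0, 0) + P.2.1 * f (0, 1, 0) + P.2.2 * f (0, 0, 1) := by
    simp only [← smul_eq_mul, ← map_smul, ← map_add]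
    congr 1
    simp
  have h1 := hf P (subset_convexHull ℝ s hP)
  rw [map_zero] at hu
  have h2 : inner ℝ !₂[f (1, 0, 0), f (0, 1, 0), f (0, 0, 1)] (toEuclidean3 P) = f P := by
    rw [hP']
    simp [toEuclidean3, PiLp.inner_apply, Fin.sum_univ_three]
  rw [h2]
  exact hu.trans h1

/-- An optimal quadruple is also optimal among the quadruples of any other closed hemisphere. -/
lemma sum_norm_sub_le_of_inner_nonneg {M : ℝ}
    (hM : ∀ A ∈ upperHemisphere, ∀ B ∈ upperHemisphere,
      ∀ C ∈ upperHemisphere, ∀ D ∈ upperHemisphere, sumDist A B C D ≤ M)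
    {w a b c d : EuclideanSpace ℝ (Fin 3)} (hw : w ≠ 0)
    (ha : ‖a‖ = 1 ∧ 0 ≤ inner ℝ w a) (hb : ‖b‖ = 1 ∧ 0 ≤ inner ℝ w b)
    (hc : ‖c‖ = 1 ∧ 0 ≤ inner ℝ w c) (hd : ‖d‖ = 1 ∧ 0 ≤ inner ℝ w d) :
    ‖a - b‖ + ‖a - c‖ + ‖a - d‖ + ‖b - c‖ + ‖b - d‖ + ‖c - d‖ ≤ M := by
  have hn : ‖‖w‖⁻¹ • w‖ = ‖northPole‖ := by
    rw [norm_smul, norm_inv, norm_norm, inv_mul_cancel₀ (norm_ne_zero_iff.2 hw)]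
    simp [northPole, EuclideanSpace.norm_eq, Fin.sum_univ_three]
  obtain ⟨U, hU⟩ := exists_linearIsometryEquiv_apply_eq hn
  have lift : ∀ x : EuclideanSpace ℝ (Fin 3), ‖x‖ = 1 ∧ 0 ≤ inner ℝ w x →
      ∃ P ∈ upperHemisphere, toEuclidean3 P = U x := by
    rintro x ⟨hx, hwx⟩
    obtain ⟨P, hP⟩ := toEuclidean3_surjective (U x)
    refine ⟨P, (mem_upperHemisphere_iff P).2 ?_, hP⟩
    rw [hP, ← hU, U.inner_map_map, U.norm_map, real_inner_smul_left]
    exact ⟨hx, by positivity⟩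
  obtain ⟨A, hA, hA'⟩ := lift a ha
  obtain ⟨B, hB, hB'⟩ := lift b hb
  obtain ⟨C, hC, hC'⟩ := lift c hc
  obtain ⟨D, hD, hD'⟩ := lift d hd
  have h := hM A hA B hB C hC D hD
  simpa only [sumDist, dist3_eq_norm_sub, hA', hB', hC', hD', ← map_sub, U.norm_map] using h

theorem center_mem_convexHull_of_optimal
    (A B C D : ℝ × ℝ × ℝ)
    (hA : A ∈ upperHemisphere) (hB : B ∈ upperHemisphere)
    (hC : C ∈ upperHemisphere) (hD : D ∈ upperHemisphere)
    (hmax : ∀ A' ∈ upperHemisphere, ∀ B' ∈ upperHemisphere,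
      ∀ C' ∈ upperHemisphere, ∀ D' ∈ upperHemisphere,
        sumDist A' B' C' D' ≤ sumDist A B C D) :
    ((0 : ℝ), (0 : ℝ), (0 : ℝ)) ∈ convexHull ℝ ({A, B, C, D} : Set (ℝ × ℝ × ℝ)) := by
  by_contra h0
  obtain ⟨w, hw⟩ := exists_inner_pos_of_notMem_convexHull (Set.toFinite {A, B, C, D}) h0
  have hwA := hw A (by simp)
  have hwB := hw B (by simp)
  have hwC := hw C (by simp)
  have hwD := hw D (by simp)
  have nA := ((mem_upperHemisphere_iff A).1 hA).1
  have nB := ((mem_upperHemisphere_iff B).1 hB).1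
  have nC := ((mem_upperHemisphere_iff C).1 hC).1
  have nD := ((mem_upperHemisphere_iff D).1 hD).1
  have hw0 : w ≠ 0 := fun h => by simp [h] at hwA
  obtain ⟨t, mA, mB, mC, mD, hAB, hAC, hAD, hBC, hBD, hCD⟩ :=
    ((eventually_retract_mem hwA).and <| (eventually_retract_mem hwB).and <|
      (eventually_retract_mem hwC).and <| (eventually_retract_mem hwD).and <|
      (eventually_eq_or_norm_sub_lt_retract nA nB hwA hwB).and <|
      (eventually_eq_or_norm_sub_lt_retract nA nC hwA hwC).and <|
      (eventually_eq_or_norm_sub_lt_retract nA nD hwA hwD).and <|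
      (eventually_eq_or_norm_sub_lt_retract nB nC hwB hwC).and <|
      (eventually_eq_or_norm_sub_lt_retract nB nD hwB hwD).and
      (eventually_eq_or_norm_sub_lt_retract nC nD hwC hwD)).exists
  have hle := sum_norm_sub_le_of_inner_nonneg hmax hw0 mA mB mC mD
  have le_of : ∀ {x y : EuclideanSpace ℝ (Fin 3)},
      x = y ∨ ‖x - y‖ < ‖retract w t x - retract w t y‖ →
        ‖x - y‖ ≤ ‖retract w t x - retract w t y‖ := by
    rintro x y (rfl | h)
    · simp
    · exact h.le
  have lAB := le_of hAB
  have lAC := le_of hAC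
  have lAD := le_of hAD
  have lBC := le_of hBC
  have lBD := le_of hBD
  have lCD := le_of hCD
  simp only [sumDist, dist3_eq_norm_sub] at hle
  have eAB : A = B := toEuclidean3_injective (hAB.resolve_right fun h => by linarith)
  have eAC : A = C := toEuclidean3_injective (hAC.resolve_right fun h => by linarith)
  have eAD : A = D := toEuclidean3_injective (hAD.resolve_right fun h => by linarith)
  subst eAB eAC eAD
  have hE : ((1, 0, 0) : ℝ × ℝ × ℝ) ∈ upperHemisphere := by simp [upperHemisphere]
  have hW : ((-1, 0, 0) : ℝ × ℝ × ℝ) ∈ upperHemisphere := by simp [upperHemisphere]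
  have h := hmax _ hE _ hW _ hW _ hW
  have hpos : 0 < dist3 (1, 0, 0) (-1, 0, 0) := by
    rw [dist3]; exact Real.sqrt_pos.2 (by norm_num)
  have hself : ∀ P, dist3 P P = 0 := fun P => by simp [dist3]
  simp only [sumDist, hself] at h
  linarith
end

section
/- Let U = {(x,y,0) : 1 − 1/32 < x ≤ 1, −1/4 < y < 1/4}, V = {(x,y,0) : −1 ≤ x < −1 + 1/32, −1/4 < y < 1/4}, and W = {(x,y,z) : −1/4 < x < 1/4, 1 − 1/32 < y ≤ 1, 0 ≤ z < 1/4}, and let A = (0,−1,0). Then for any points B ∈ U ∩ S¹, C ∈ V ∩ S¹, and D ∈ W ∩ S²_{≥0}, the sum of the six pairwise Euclidean distances satisfies |AB| + |BC| + |CA| + |DA| + |DB| + |DC| ≤ 4 + 4√2. -/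
/-- Tangent-line bound for the square root at `a ^ 2`. -/
theorem sqrt_le_tangent_s4 {u a : ℝ} (hu : 0 ≤ u) (ha : 0 < a) :
    Real.sqrt u ≤ (u + a ^ 2) / (2 * a) := by
  rw [le_div_iff₀ (by positivity)]
  nlinarith [Real.sq_sqrt hu, sq_nonneg (Real.sqrt u - a)]

theorem sqrt_le_tangent_two {u : ℝ} (hu : 0 ≤ u) :
    Real.sqrt u ≤ Real.sqrt 2 * (u + 2) / 4 := by
  have h := sqrt_le_tangent_s4 hu (a := Real.sqrt 2) (by positivity)
  have h2 : Real.sqrt 2 ^ 2 = 2 := Real.sq_sqrt (by norm_num)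
  refine h.trans_eq ?_
  rw [h2, div_eq_div_iff (by positivity) (by norm_num)]
  linear_combination -2 * (u + 2) * h2

/-- The cross term `(A + D) ⬝ (B + C)` is dominated by `|A + D| ^ 2 + |B + C| ^ 2` when
`A = (0, -1, 0)`, `B = (p, b, 0)`, `C = (-q, c, 0)` and `D = (x, y, z)`. -/
theorem neg_cross_term_le {p b q c x y z : ℝ}
    (hp : 31 / 32 < p) (hq : 31 / 32 < q) (hb : |b| < 1 / 4) (hc : |c| < 1 / 4)
    (hpb : p ^ 2 + b ^ 2 = 1) (hqc : q ^ 2 + c ^ 2 = 1)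
    (hy : y ≤ 1) (hxyz : x ^ 2 + y ^ 2 + z ^ 2 = 1) :
    -(x * (p - q) + (y - 1) * (b + c)) ≤
      7 / 20 * (2 * (1 - y) + ((p - q) ^ 2 + (b + c) ^ 2)) := by
  rw [abs_lt] at hb hc
  obtain ⟨t, ht⟩ : ∃ t, t = (c - b) / (p + q) := ⟨_, rfl⟩
  have hpq : 0 < p + q := by linarith
  have hfac : p - q = t * (b + c) := by
    rw [ht]
    field_simp
    linear_combination hpb - hqc
  have ht_le : t ≤ 3 / 10 := by
    rw [ht, div_le_iff₀ hpq]; linarith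
  have ht_ge : -(3 / 10) ≤ t := by
    rw [ht, le_div_iff₀ hpq]; linarith
  have htsq : t ^ 2 ≤ 9 / 100 := by nlinarith
  have hx : x ^ 2 ≤ 2 * (1 - y) := by nlinarith [sq_nonneg (1 - y), sq_nonneg z]
  have hlin : (1 - y) * (b + c) ≤ (1 - y) * (1 / 2) :=
    mul_le_mul_of_nonneg_left (by linarith) (by linarith)
  rw [hfac]
  nlinarith [sq_nonneg (x + 5 * (t * (b + c))), sq_nonneg (t * (b + c)),
    mul_nonneg (sub_nonneg.2 htsq) (sq_nonneg (b + c))]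


/-- The equator `S¹ = {(x, y, 0) : x² + y² = 1}`. -/
def equator : Set (ℝ × ℝ × ℝ) :=
  {p | p.1 ^ 2 + p.2.1 ^ 2 = 1 ∧ p.2.2 = 0}

/-- The region `U`. -/
def regionU : Set (ℝ × ℝ × ℝ) :=
  {p | 1 - 1/32 < p.1 ∧ p.1 ≤ 1 ∧ -(1/4) < p.2.1 ∧ p.2.1 < 1/4 ∧ p.2.2 = 0}

/-- The region `V`. -/
def regionV : Set (ℝ × ℝ × ℝ) :=
  {p | -1 ≤ p.1 ∧ p.1 < -1 + 1/32 ∧ -(1/4) < p.2.1 ∧ p.2.1 < 1/4 ∧ p.2.2 = 0}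

/-- The region `W`. -/
def regionW : Set (ℝ × ℝ × ℝ) :=
  {p | -(1/4) < p.1 ∧ p.1 < 1/4 ∧ 1 - 1/32 < p.2.1 ∧ p.2.1 ≤ 1 ∧
       0 ≤ p.2.2 ∧ p.2.2 < 1/4}

theorem sum_dist_le_on_local_regions
    (B C D : ℝ × ℝ × ℝ)
    (hB : B ∈ regionU ∩ equator)
    (hC : C ∈ regionV ∩ equator)
    (hD : D ∈ regionW ∩ upperHemisphere) :
    dist3 ((0 : ℝ), (-1 : ℝ), (0 : ℝ)) B + dist3 B C + dist3 C ((0 : ℝ), (-1 : ℝ), (0 : ℝ)) +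
      dist3 D ((0 : ℝ), (-1 : ℝ), (0 : ℝ)) + dist3 D B + dist3 D C
      ≤ 4 + 4 * Real.sqrt 2 := by
  obtain ⟨p, b, w⟩ := B
  obtain ⟨q, c, v⟩ := C
  obtain ⟨x, y, z⟩ := D
  obtain ⟨⟨hp, -, hb, hb', rfl⟩, hpb, -⟩ := hB
  obtain ⟨⟨-, hq, hc, hc', rfl⟩, hqc, -⟩ := hC
  obtain ⟨⟨-, -, -, hy, -, -⟩, hxyz, -⟩ := hD
  dsimp only at *
  have hcross := neg_cross_term_le (p := p) (q := -q) (by linarith) (by linarith)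
    (abs_lt.2 ⟨hb, hb'⟩) (abs_lt.2 ⟨hc, hc'⟩) hpb (by linarith) hy hxyz
  set e := x * (p - -q) + (y - 1) * (b + c) with he
  set m := 2 * (1 - y) + ((p - -q) ^ 2 + (b + c) ^ 2) with hm
  have hm0 : 0 ≤ m := by rw [hm]; have := sub_nonneg.2 hy; positivity
  have hs : 7 / 5 ≤ Real.sqrt 2 := Real.le_sqrt_of_sq_le (by norm_num)
  have hs2 : Real.sqrt 2 ^ 2 = 2 := Real.sq_sqrt (by norm_num)
  have hs_le : Real.sqrt 2 ≤ 10 / 7 := by nlinarith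
  have hmain : Real.sqrt 2 * -e ≤ m / 2 := by
    have := mul_le_mul_of_nonneg_left hcross (Real.sqrt_nonneg 2)
    nlinarith [mul_le_mul_of_nonneg_right hs_le hm0]
  simp only [dist3]
  have hAB := sqrt_le_tangent_two
    (u := (0 - p) ^ 2 + (-1 - b) ^ 2 + (0 - 0) ^ 2) (by positivity)
  have hCA := sqrt_le_tangent_two
    (u := (q - 0) ^ 2 + (c - -1) ^ 2 + (0 - 0) ^ 2) (by positivity)
  have hDB := sqrt_le_tangent_two
    (u := (x - p) ^ 2 + (y - b) ^ 2 + (z - 0) ^ 2) (by positivity)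
  have hDC := sqrt_le_tangent_two
    (u := (x - q) ^ 2 + (y - c) ^ 2 + (z - 0) ^ 2) (by positivity)
  have hBC := sqrt_le_tangent_s4
    (u := (p - q) ^ 2 + (b - c) ^ 2 + (0 - 0) ^ 2) (by positivity) zero_lt_two
  have hDA := sqrt_le_tangent_s4
    (u := (x - 0) ^ 2 + (y - -1) ^ 2 + (z - 0) ^ 2) (by positivity) zero_lt_two
  have hsides : (0 - p) ^ 2 + (-1 - b) ^ 2 + (0 - 0) ^ 2 +
      ((q - 0) ^ 2 + (c - -1) ^ 2 + (0 - 0) ^ 2) +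
      ((x - p) ^ 2 + (y - b) ^ 2 + (z - 0) ^ 2) +
      ((x - q) ^ 2 + (y - c) ^ 2 + (z - 0) ^ 2) = 8 - 2 * e := by
    rw [he]; linear_combination 2 * hpb + 2 * hqc + 2 * hxyz
  have hdiag : (p - q) ^ 2 + (b - c) ^ 2 + (0 - 0) ^ 2 +
      ((x - 0) ^ 2 + (y - -1) ^ 2 + (z - 0) ^ 2) = 8 - m := by
    rw [hm]; linear_combination 2 * hpb + 2 * hqc + hxyz
  linear_combination hAB + hCA + hDB + hDC + hBC + hDA + hmain / 2 +
    Real.sqrt 2 / 4 * hsides + hdiag / 4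
end

section
/- Let x₁, x₂, …, xₙ be positive real numbers with xᵢ ≤ r for all i, let d₁, d₂, …, dₙ be positive integers, and set N = d₁ + d₂ + ⋯ + dₙ, with N ≥ 2. Then x₁^{d₁} x₂^{d₂} ⋯ xₙ^{dₙ} ≤ (r^{N−2}/N) · (d₁x₁² + d₂x₂² + ⋯ + dₙxₙ²). -/
open Finset in
theorem prod_pow_le_weighted_sq_sum
    (n : ℕ) (x : Fin n → ℝ) (d : Fin n → ℕ) (r : ℝ) (hr : 0 < r)
    (hx : ∀ i, 0 < x i) (hxr : ∀ i, x i ≤ r)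
    (hd : ∀ i, 0 < d i)
    (N : ℕ) (hN : N = ∑ i, d i) (hN2 : 2 ≤ N) :
    ∏ i, x i ^ d i ≤
      r ^ (N - 2) / (N : ℝ) * ∑ i, (d i : ℝ) * x i ^ 2 := by
  have hN0 : N ≠ 0 := by lia
  have hsum : ∑ i, (d i : ℝ) = N := by rw [hN]; push_cast; rfl
  have hP : 0 ≤ ∏ i, x i ^ d i := prod_nonneg fun i _ => (pow_pos (hx i) _).le
  -- The weighted geometric mean `g` satisfies `g ≤ r` and, by AM-GM, `g ^ 2` is at most
  -- the weighted mean of the squares.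
  obtain ⟨g, hg, hgdef⟩ : ∃ g : ℝ, 0 ≤ g ∧ g = (∏ i, x i ^ d i) ^ (N : ℝ)⁻¹ :=
    ⟨_, Real.rpow_nonneg hP _, rfl⟩
  have hgN : g ^ N = ∏ i, x i ^ d i := by rw [hgdef, Real.rpow_inv_natCast_pow hP hN0]
  have hgr : g ≤ r := by
    refine le_of_pow_le_pow_left₀ hN0 hr.le ?_
    rw [hgN, hN, ← prod_pow_eq_pow_sum]
    exact prod_le_prod (fun i _ => (pow_pos (hx i) _).le)
      fun i _ => pow_le_pow_left₀ (hx i).le (hxr i) _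
  have hg2 : g ^ 2 ≤ (∑ i, (d i : ℝ) * x i ^ 2) / N := by
    have key := Real.geom_mean_le_arith_mean univ (fun i => (d i : ℝ)) (fun i => x i ^ 2)
      (fun i _ => Nat.cast_nonneg _) (by rw [hsum]; positivity) (fun i _ => sq_nonneg _)
    simp only [Real.rpow_natCast, hsum] at key
    simp_rw [pow_right_comm _ 2, prod_pow, ← hgN, pow_right_comm _ N 2] at key
    rwa [Real.pow_rpow_inv_natCast (sq_nonneg g) hN0] at key
  calc ∏ i, x i ^ d i = g ^ (N - 2) * g ^ 2 := by
        rw [← hgN, ← pow_add, Nat.sub_add_cancel hN2]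
    _ ≤ r ^ (N - 2) * ((∑ i, (d i : ℝ) * x i ^ 2) / N) := by gcongr
    _ = r ^ (N - 2) / (N : ℝ) * ∑ i, (d i : ℝ) * x i ^ 2 := by ring
end

section
/- Define k₂₀(s,t,u) = −8√2 s² − 8√2 t² − 8√2 u² + 8√2 su − 8√2 tu − 16st − 8t² − 8s², and q₂(s,t,u) = k₂₀(s,t,u) + (122√2/147 + 453/196)s² + (122√2/147 + 453/196)t² + (164√2/147 + 73/49)u². Then q₂(s,t,u) ≤ 0 for all real s, t, u; equivalently, the symmetric 3×3 matrix with diagonal entries −2108√2/147 − 1115/98, −2108√2/147 − 1115/98, −2024√2/147 + 146/49 and off-diagonal entries M₁₂ = M₂₁ = −16, M₁₃ = M₃₁ = 8√2, M₂₃ = M₃₂ = −8√2 is negative semidefinite. -/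
/-- Minus the Hessian form of `q₂`, which equals `-2 q₂`, is nonnegative. -/
theorem neg_hessian_q2_nonneg (s t u : ℝ) :
    0 ≤ (2108 * Real.sqrt 2 / 147 + 1115 / 98) * (s ^ 2 + t ^ 2) +
      (2024 * Real.sqrt 2 / 147 - 146 / 49) * u ^ 2 + 32 * s * t -
      16 * Real.sqrt 2 * u * (s - t) := by
  have hsq : Real.sqrt 2 ^ 2 = 2 := Real.sq_sqrt (by norm_num)
  have hlb : 1.4142 ≤ Real.sqrt 2 := Real.le_sqrt_of_sq_le (by norm_num)
  generalize Real.sqrt 2 = r at hsq hlb ⊢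
  have hA : 31.65 ≤ 2108 * r / 147 + 1115 / 98 := by linarith
  have hC : 16.49 ≤ 2024 * r / 147 - 146 / 49 := by linarith
  have h₁ := mul_le_mul_of_nonneg_right hA (by positivity : 0 ≤ s ^ 2 + t ^ 2)
  have h₂ := mul_le_mul_of_nonneg_right hC (sq_nonneg u)
  have h₃ : (16.49 * u - 8 * r * (s - t)) ^ 2 =
      16.49 * (16.49 * u ^ 2 - 16 * r * u * (s - t)) + 128 * (s - t) ^ 2 := by
    linear_combination 64 * (s - t) ^ 2 * hsq
  have h₄ := sq_nonneg (16.49 * u - 8 * r * (s - t))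
  linarith [sq_nonneg (s + t), sq_nonneg (s - t)]

/-- `q₂(s,t,u) ≤ 0` for all real `s, t, u`; equivalently, the associated symmetric
matrix is negative semidefinite (expressed here as: its negation is positive
semidefinite, since `Matrix.NegSemidef` is not available). -/
theorem q2_nonpos_and_matrix_negSemidef :
    (∀ s t u : ℝ,
      (-8 * Real.sqrt 2 * s ^ 2 - 8 * Real.sqrt 2 * t ^ 2 - 8 * Real.sqrt 2 * u ^ 2 +
          8 * Real.sqrt 2 * s * u - 8 * Real.sqrt 2 * t * u - 16 * s * t -
          8 * t ^ 2 - 8 * s ^ 2) +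
        (122 * Real.sqrt 2 / 147 + 453 / 196) * s ^ 2 +
        (122 * Real.sqrt 2 / 147 + 453 / 196) * t ^ 2 +
        (164 * Real.sqrt 2 / 147 + 73 / 49) * u ^ 2 ≤ 0) ∧
    (-(!![-2108 * Real.sqrt 2 / 147 - 1115 / 98, -16, 8 * Real.sqrt 2;
          -16, -2108 * Real.sqrt 2 / 147 - 1115 / 98, -8 * Real.sqrt 2;
          8 * Real.sqrt 2, -8 * Real.sqrt 2,
            -2024 * Real.sqrt 2 / 147 + 146 / 49] : Matrix (Fin 3) (Fin 3) ℝ)).PosSemidef := by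
  constructor
  · intro s t u
    linarith [neg_hessian_q2_nonneg s t u]
  · refine Matrix.PosSemidef.of_dotProduct_mulVec_nonneg ?_ fun x => ?_
    · ext i j
      fin_cases i <;> fin_cases j <;> simp
    · have h := neg_hessian_q2_nonneg (x 0) (x 1) (x 2)
      simp only [dotProduct, Matrix.mulVec, Fin.sum_univ_three, Matrix.neg_apply,
        Pi.star_apply, star_trivial, Matrix.of_apply, Matrix.cons_val]
      linarith
end

section
/- Define k₃₀(s,t,u) = −12√2 (s+t) u² + 4√2 (t² − s²) u. Then for all s, t, u ∈ [−1/7, 1/7] with s + t ≥ 0, one has k₃₀(s,t,u) ≤ (8√2/21)(s² + t² + u²). -/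
theorem k30_bound (s t u : ℝ)
    (hs : s ∈ Set.Icc (-(1/7) : ℝ) (1/7))
    (ht : t ∈ Set.Icc (-(1/7) : ℝ) (1/7))
    (hu : u ∈ Set.Icc (-(1/7) : ℝ) (1/7))
    (hst : 0 ≤ s + t) :
    -12 * Real.sqrt 2 * (s + t) * u ^ 2 + 4 * Real.sqrt 2 * (t ^ 2 - s ^ 2) * u
      ≤ 8 * Real.sqrt 2 / 21 * (s ^ 2 + t ^ 2 + u ^ 2) := by
  have hquad : (t - s) * u - 3 * u ^ 2 ≤ (t - s) ^ 2 / 12 := by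
    nlinarith [sq_nonneg (t - s - 6 * u)]
  have hsum : s + t ≤ 2 / 7 := by linarith [hs.2, ht.2]
  have key : (s + t) * ((t - s) * u - 3 * u ^ 2) ≤ 2 / 21 * (s ^ 2 + t ^ 2 + u ^ 2) :=
    calc (s + t) * ((t - s) * u - 3 * u ^ 2)
        ≤ (s + t) * ((t - s) ^ 2 / 12) := by gcongr
      _ ≤ 2 / 7 * ((t - s) ^ 2 / 12) := by gcongr
      _ ≤ 2 / 21 * (s ^ 2 + t ^ 2 + u ^ 2) := by
        nlinarith [sq_nonneg (s + t), sq_nonneg (t - s), sq_nonneg u]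
  calc -12 * Real.sqrt 2 * (s + t) * u ^ 2 + 4 * Real.sqrt 2 * (t ^ 2 - s ^ 2) * u
      = 4 * Real.sqrt 2 * ((s + t) * ((t - s) * u - 3 * u ^ 2)) := by ring
    _ ≤ 4 * Real.sqrt 2 * (2 / 21 * (s ^ 2 + t ^ 2 + u ^ 2)) := by gcongr
    _ = 8 * Real.sqrt 2 / 21 * (s ^ 2 + t ^ 2 + u ^ 2) := by ring
end
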